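/- For each n ≥ 1 let 𝓘_n denote the set of pairs (F, J) where F is an acyclic simple graph (forest) on the vertex set Fin n and J is a maximal independent set of F, let i_n = |𝓘_n|, and let E_n = (Σ_{(F,J) ∈ 𝓘_n} |J|) / i_n. Then the sequence E_n / n converges as n → ∞ to a limit μ satisfying 0.46392 < μ < 0.46393. -/

import Mathlib

open Filter Topology MeasureTheory

/-- `J` is an independent set of the simple graph `G`. -/
def IsIndepSet {V : Type*} (G : SimpleGraph V) (J : Set V) : Prop :=
  ∀ ⦃u v : V⦄, u ∈ J → v ∈ J → ¬ G.Adj u v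

/-- `J` is a maximal independent set of `G`. -/
def IsMaximalIndepSet {V : Type*} (G : SimpleGraph V) (J : Set V) : Prop :=
  IsIndepSet G J ∧ ∀ J' : Set V, IsIndepSet G J' → ¬ J ⊂ J'

/-- The pairs `(F, J)` where `F` is a forest (acyclic simple graph) on `Fin n`
and `J` is a maximal independent set of `F`. -/
def MISpace (n : ℕ) :=
  {p : SimpleGraph (Fin n) × Set (Fin n) // p.1.IsAcyclic ∧ IsMaximalIndepSet p.1 p.2}

/-- `iN n` is the number of pairs `(F, J)` where `F` is a forest on `Fin n`
and `J` is a maximal independent set of `F`. -/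
noncomputable def iN (n : ℕ) : ℕ := Nat.card (MISpace n)

/-- The expected size of a uniformly random maximal independent set–forest
pair on `n` vertices: the arithmetic mean of `|J|` over all pairs `(F, J)`. -/
noncomputable def En (n : ℕ) : ℝ :=
  (∑ᶠ p : MISpace n, (p.val.2.ncard : ℝ)) / (iN n : ℝ)

/-- `T` is a tree with vertex set `S` containing the root `r`, seen as a graph on an ambient type. -/
structure IsTreeOn {V : Type*} (S : Finset V) (r : V) (T : SimpleGraph V) : Prop where
  acyclic : T.IsAcyclic
  adj_mem : ∀ a b, T.Adj a b → a ∈ S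
  reach : ∀ v ∈ S, T.Reachable r v
  root_mem : r ∈ S

/-- Join two graphs by the edge `rs`. -/
def graft {V : Type*} (r s : V) (T₁ T₂ : SimpleGraph V) : SimpleGraph V :=
  T₁ ⊔ T₂ ⊔ SimpleGraph.edge r s

/-- The edges of `T` with both endpoints in `K`. -/
def restrictTo {V : Type*} (T : SimpleGraph V) (K : Finset V) : SimpleGraph V where
  Adj a b := T.Adj a b ∧ a ∈ K ∧ b ∈ K
  symm := ⟨fun _ _ h => ⟨h.1.symm, h.2.2, h.2.1⟩⟩
  loopless := ⟨fun _ h => h.1.ne rfl⟩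

section Trees

variable {V : Type*} {S K L : Finset V} {r s v : V} {T T₁ T₂ : SimpleGraph V}

theorem IsTreeOn.adj_mem_right (h : IsTreeOn S r T) {a b : V} (hab : T.Adj a b) : b ∈ S :=
  h.adj_mem b a hab.symm

theorem SimpleGraph.Reachable.induction_on_adj {G : SimpleGraph V} {P : V → Prop} {a b : V}
    (h : G.Reachable a b) (ha : P a) (step : ∀ x y, G.Reachable a x → P x → G.Adj x y → P y) :
    P b := by
  rw [SimpleGraph.reachable_iff_reflTransGen] at h
  induction h with
  | refl => exact ha
  | tail hab hbc ih =>
    exact step _ _ ((SimpleGraph.reachable_iff_reflTransGen _ _).2 hab) ih hbc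

theorem walk_edges_mem_of_sup (hKL : Disjoint K L)
    (h₁ : ∀ a b, T₁.Adj a b → a ∈ K) (h₂ : ∀ a b, T₂.Adj a b → a ∈ L)
    {a b : V} (p : (T₁ ⊔ T₂).Walk a b) (ha : a ∈ K) : ∀ e ∈ p.edges, e ∈ T₁.edgeSet := by
  induction p with
  | nil => simp
  | @cons x y z hxy q ih =>
    have hT : T₁.Adj x y := by
      rcases hxy with h | h
      · exact h
      · exact absurd (h₂ _ _ h) (Finset.disjoint_left.1 hKL ha)
    intro e he
    rw [SimpleGraph.Walk.edges_cons, List.mem_cons] at he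
    rcases he with rfl | he
    · exact hT
    · exact ih (h₁ _ _ hT.symm) e he

theorem isAcyclic_sup_of_disjoint (hKL : Disjoint K L)
    (h₁ : ∀ a b, T₁.Adj a b → a ∈ K) (h₂ : ∀ a b, T₂.Adj a b → a ∈ L)
    (a₁ : T₁.IsAcyclic) (a₂ : T₂.IsAcyclic) : (T₁ ⊔ T₂).IsAcyclic := by
  intro a c hc
  by_cases ha : a ∈ K
  · exact a₁ _ (hc.transfer (walk_edges_mem_of_sup hKL h₁ h₂ c ha))
  · by_cases hb : a ∈ L
    · have : ∀ e ∈ c.edges, e ∈ T₂.edgeSet := by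
        have := walk_edges_mem_of_sup hKL.symm h₂ h₁ (c.mapLe (sup_comm T₁ T₂).le) hb
        simpa using this
      exact a₂ _ (hc.transfer this)
    · cases c with
      | nil => exact hc.ne_nil rfl
      | cons h q =>
        rcases h with h | h
        · exact ha (h₁ _ _ h)
        · exact hb (h₂ _ _ h)

theorem graft_adj {a b : V} (hrs : r ≠ s) : (graft r s T₁ T₂).Adj a b ↔
    T₁.Adj a b ∨ T₂.Adj a b ∨ (a = r ∧ b = s) ∨ (a = s ∧ b = r) := by
  simp only [graft, SimpleGraph.sup_adj, SimpleGraph.edge_adj]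
  grind

theorem IsTreeOn.graft [DecidableEq V] (h₁ : IsTreeOn K s T₁) (h₂ : IsTreeOn L r T₂)
    (hKL : Disjoint K L) : IsTreeOn (K ∪ L) r (graft r s T₁ T₂) := by
  have hrs : r ≠ s := fun h =>
    Finset.disjoint_left.1 hKL h₁.root_mem (h ▸ h₂.root_mem)
  have hrK : r ∉ K := fun h => Finset.disjoint_left.1 hKL h h₂.root_mem
  refine ⟨?_, ?_, ?_, Finset.mem_union_right _ h₂.root_mem⟩
  · refine (isAcyclic_sup_of_disjoint hKL h₁.adj_mem h₂.adj_mem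
      h₁.acyclic h₂.acyclic).sup_edge_of_not_reachable ?_
    intro h
    refine hrK ?_
    refine SimpleGraph.Reachable.induction_on_adj (P := (· ∈ K)) h.symm h₁.root_mem ?_
    rintro x y - hx (hxy | hxy)
    · exact h₁.adj_mem_right hxy
    · exact absurd (h₂.adj_mem _ _ hxy) (Finset.disjoint_left.1 hKL hx)
  · intro a b hab
    rw [graft_adj hrs] at hab
    have := h₁.adj_mem a b
    have := h₂.adj_mem a b
    have := h₁.root_mem
    have := h₂.root_mem
    grind
  · intro v hv
    have hadj : (_root_.graft r s T₁ T₂).Adj r s := by rw [graft_adj hrs]; grind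
    rcases Finset.mem_union.1 hv with hv | hv
    · exact hadj.reachable.trans ((h₁.reach v hv).mono (le_sup_left.trans le_sup_left))
    · exact (h₂.reach v hv).mono (le_sup_right.trans le_sup_left)

theorem IsTreeOn.exists_decomposition [DecidableEq V] (h : IsTreeOn S r T) (hv : v ∈ S)
    (hvr : v ≠ r) :
    ∃ K s, K ⊆ S ∧ v ∈ K ∧ r ∉ K ∧ IsTreeOn K s (restrictTo T K) ∧
      IsTreeOn (S \ K) r (restrictTo T (S \ K)) ∧
      T = _root_.graft r s (restrictTo T K) (restrictTo T (S \ K)) := by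
  classical
  obtain ⟨p, hp⟩ := (h.reach v hv).exists_isPath
  cases p with
  | nil => exact absurd rfl hvr
  | @cons _ s _ hrs q =>
    rw [SimpleGraph.Walk.cons_isPath_iff] at hp
    set T' := T.deleteEdges {s(r, s)} with hT'
    have hadj : ∀ a b, T'.Adj a b ↔ T.Adj a b ∧ ¬ ((a = r ∧ b = s) ∨ (a = s ∧ b = r)) := by
      intro a b
      simp [hT', SimpleGraph.deleteEdges_adj]
    have hnr : ¬ T'.Reachable s r := by
      have := (SimpleGraph.isAcyclic_iff_forall_adj_isBridge.1 h.acyclic) hrs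
      rw [SimpleGraph.isBridge_iff] at this
      exact fun h' => this h'.symm
    have hsv : T'.Reachable s v := by
      refine ⟨q.toDeleteEdges _ ?_⟩
      intro e he
      rintro rfl
      exact hp.2 (q.fst_mem_support_of_mem_edges he)
    have hle : T' ≤ T := SimpleGraph.deleteEdges_le _
    let K := S.filter fun w => T'.Reachable s w
    have hK : ∀ w, w ∈ K ↔ w ∈ S ∧ T'.Reachable s w := by intro w; simp [K]
    have hsS : s ∈ S := h.adj_mem_right hrs
    have hsK : s ∈ K := (hK s).2 ⟨hsS, SimpleGraph.Reachable.rfl⟩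
    have hrK : r ∉ K := fun h => hnr ((hK r).1 h).2
    have hor : ∀ w, T.Reachable r w → T'.Reachable r w ∨ T'.Reachable s w := by
      intro w hw
      refine SimpleGraph.Reachable.induction_on_adj
        (P := fun w => T'.Reachable r w ∨ T'.Reachable s w) hw (Or.inl .rfl) ?_
      intro x y _ hx hxy
      by_cases hc : (x = r ∧ y = s) ∨ (x = s ∧ y = r)
      · rcases hc with ⟨-, rfl⟩ | ⟨-, rfl⟩
        · exact Or.inr .rfl
        · exact Or.inl .rfl
      · have := ((hadj x y).2 ⟨hxy, hc⟩).reachable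
        exact hx.imp (·.trans this) (·.trans this)
    refine ⟨K, s, Finset.filter_subset _ _, (hK v).2 ⟨hv, hsv⟩, hrK,
      ⟨h.acyclic.anti fun a b hab => hab.1, fun a b hab => hab.2.1, ?_, hsK⟩,
      ⟨h.acyclic.anti fun a b hab => hab.1, fun a b hab => hab.2.1, ?_, ?_⟩, ?_⟩
    · intro w hw
      refine SimpleGraph.Reachable.induction_on_adj
        (P := fun w => (restrictTo T K).Reachable s w) ((hK w).1 hw).2 .rfl ?_
      intro x y hx hP hxy
      refine hP.trans (SimpleGraph.Adj.reachable ?_)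
      exact ⟨hle hxy, (hK x).2 ⟨h.adj_mem _ _ (hle hxy), hx⟩,
        (hK y).2 ⟨h.adj_mem_right (hle hxy), hx.trans hxy.reachable⟩⟩
    · intro w hw
      rw [Finset.mem_sdiff] at hw
      have hrw : T'.Reachable r w :=
        (hor w (h.reach w hw.1)).resolve_right fun h' => hw.2 ((hK w).2 ⟨hw.1, h'⟩)
      refine SimpleGraph.Reachable.induction_on_adj
        (P := fun w => (restrictTo T (S \ K)).Reachable r w) hrw .rfl ?_
      intro x y hx hP hxy
      refine hP.trans (SimpleGraph.Adj.reachable ?_)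
      refine ⟨hle hxy, Finset.mem_sdiff.2 ⟨h.adj_mem _ _ (hle hxy), fun hxK => ?_⟩,
        Finset.mem_sdiff.2 ⟨h.adj_mem_right (hle hxy), fun hyK => ?_⟩⟩
      · exact hnr (((hK x).1 hxK).2.trans hx.symm)
      · exact hnr (((hK y).1 hyK).2.trans (hx.trans hxy.reachable).symm)
    · exact Finset.mem_sdiff.2 ⟨h.root_mem, hrK⟩
    · ext a b
      rw [graft_adj hrs.ne]
      constructor
      · intro hab
        by_cases hc : (a = r ∧ b = s) ∨ (a = s ∧ b = r)
        · exact Or.inr (Or.inr hc)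
        · have h' := (hadj a b).2 ⟨hab, hc⟩
          have haS := h.adj_mem _ _ hab
          have hbS := h.adj_mem_right hab
          by_cases haK : a ∈ K
          · exact Or.inl ⟨hab, haK, (hK b).2 ⟨hbS, ((hK a).1 haK).2.trans h'.reachable⟩⟩
          · refine Or.inr (Or.inl ⟨hab, Finset.mem_sdiff.2 ⟨haS, haK⟩,
              Finset.mem_sdiff.2 ⟨hbS, fun hbK => haK ?_⟩⟩)
            exact (hK a).2 ⟨haS, ((hK b).1 hbK).2.trans h'.symm.reachable⟩
      · rintro (hab | hab | ⟨rfl, rfl⟩ | ⟨rfl, rfl⟩)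
        · exact hab.1
        · exact hab.1
        · exact hrs
        · exact hrs.symm

theorem mem_iff_of_graft (h₁ : IsTreeOn K s T₁) (h₂ : IsTreeOn L r T₂) (hKL : Disjoint K L)
    (hv : v ∈ K) (w : V) :
    w ∈ K ↔ ((graft r s T₁ T₂).deleteIncidenceSet r).Reachable v w := by
  have hrs : r ≠ s := fun h =>
    Finset.disjoint_left.1 hKL h₁.root_mem (h ▸ h₂.root_mem)
  have hrK : r ∉ K := fun h => Finset.disjoint_left.1 hKL h h₂.root_mem
  constructor
  · intro hw
    refine SimpleGraph.Reachable.mono ?_ ((h₁.reach v hv).symm.trans (h₁.reach w hw))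
    intro a b hab
    rw [SimpleGraph.deleteIncidenceSet_adj, graft_adj hrs]
    refine ⟨Or.inl hab, ?_, ?_⟩
    · rintro rfl; exact hrK (h₁.adj_mem _ _ hab)
    · rintro rfl; exact hrK (h₁.adj_mem_right hab)
  · intro h
    refine SimpleGraph.Reachable.induction_on_adj (P := (· ∈ K)) h hv ?_
    intro x y _ hx hxy
    rw [SimpleGraph.deleteIncidenceSet_adj, graft_adj hrs] at hxy
    rcases hxy.1 with h | h | h | h
    · exact h₁.adj_mem_right h
    · exact absurd (h₂.adj_mem _ _ h) (Finset.disjoint_left.1 hKL hx)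
    · exact absurd h.1 hxy.2.1
    · exact absurd h.2 hxy.2.2

theorem graft_injective [DecidableEq V] {K' : Finset V} {s' : V} {T₁' T₂' : SimpleGraph V}
    (h₁ : IsTreeOn K s T₁) (h₂ : IsTreeOn (S \ K) r T₂)
    (h₁' : IsTreeOn K' s' T₁') (h₂' : IsTreeOn (S \ K') r T₂') (hv : v ∈ K) (hv' : v ∈ K')
    (heq : graft r s T₁ T₂ = graft r s' T₁' T₂') :
    K = K' ∧ s = s' ∧ T₁ = T₁' ∧ T₂ = T₂' := by
  obtain rfl : K = K' := by
    ext w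
    rw [mem_iff_of_graft h₁ h₂ Finset.disjoint_sdiff hv,
      mem_iff_of_graft h₁' h₂' Finset.disjoint_sdiff hv', heq]
  have m₁ := h₁.adj_mem
  have m₂ := h₂.adj_mem
  have m₁' := h₁'.adj_mem
  have m₂' := h₂'.adj_mem
  have hs := h₁.root_mem
  have hs' := h₁'.root_mem
  have hr := h₂.root_mem
  have hrs : r ≠ s := by grind
  have hrs' : r ≠ s' := by grind
  have hA := fun a b => (graft_adj (T₁ := T₁) (T₂ := T₂) (a := a) (b := b) hrs).symm.trans
    ((iff_of_eq (congrArg (fun G => G.Adj a b) heq)).trans (graft_adj hrs'))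
  simp only [Finset.mem_sdiff] at m₂ m₂' hr
  have hss : s = s' := by
    have := hA r s
    have := m₁' r s
    have := m₂' s r
    have := T₂'.adj_comm r s
    grind
  subst hss
  refine ⟨rfl, rfl, ?_, ?_⟩
  · ext a b
    have := hA a b
    have := m₁ a b
    have := m₁' a b
    have := m₂ a b
    have := m₂' a b
    have := m₁ b a
    have := m₁' b a
    have := T₁.adj_comm a b
    have := T₁'.adj_comm a b
    grind
  · ext a b
    have := hA a b
    have := m₁ a b
    have := m₁' a b
    have := m₂ a b
    have := m₂' a b
    have := m₂ b a
    have := m₂' b a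
    have := T₂.adj_comm a b
    have := T₂'.adj_comm a b
    grind

end Trees

/-- The situation of the root of a rooted tree with a selected set of vertices: it is selected, or it
has no selected neighbour (undominated), or it is dominated by a selected neighbour. -/
inductive RootState
  | sel
  | und
  | dom

namespace RootState

instance : DecidableEq RootState
  | sel, sel | und, und | dom, dom => isTrue rfl
  | sel, und | sel, dom | und, sel | und, dom | dom, sel | dom, und => isFalse nofun

instance : Fintype RootState where
  elems := {sel, und, dom}
  complete := by rintro (_ | _ | _) <;> decide

/-- The state of the root after a tree with root state `c` is hung below a root of state `q`, when
this is allowed. -/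
def comb : RootState → RootState → Option RootState
  | sel, sel => none
  | und, sel => some sel
  | dom, sel => some sel
  | sel, und => some dom
  | und, und => none
  | dom, und => some und
  | sel, dom => some dom
  | und, dom => none
  | dom, dom => some dom

end RootState

open RootState

/-- `J` is an independent set of the tree `T` on `S` which dominates every vertex except possibly the
root `r`. -/
structure IsRootedMIS {V : Type*} (S : Finset V) (r : V) (T : SimpleGraph V) (J : Finset V) :
    Prop where
  tree : IsTreeOn S r T
  subset : J ⊆ S
  indep : ∀ a ∈ J, ∀ b ∈ J, ¬ T.Adj a b
  dominated : ∀ v ∈ S, v ≠ r → v ∉ J → ∃ w ∈ J, T.Adj v w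

open scoped Classical in
/-- The state of the vertex `r` with respect to the selected set `J` in `T`. -/
noncomputable def rootState {V : Type*} (r : V) (T : SimpleGraph V) (J : Finset V) : RootState :=
  if r ∈ J then sel else if ∃ w ∈ J, T.Adj r w then dom else und

/-- Pairs `(T, J)` where `J` is as in `IsRootedMIS`, with root state `τ`. -/
def RootedMIS {V : Type*} (S : Finset V) (r : V) (τ : RootState) :
    Set (SimpleGraph V × Finset V) :=
  {p | IsRootedMIS S r p.1 p.2 ∧ rootState r p.1 p.2 = τ}

section Decomposition

variable {V : Type*} {S K L J J₁ J₂ : Finset V} {r s v : V} {T T₁ T₂ : SimpleGraph V}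
  {τ c q : RootState}

theorem rootState_eq_sel : rootState r T J = sel ↔ r ∈ J := by
  unfold rootState; split_ifs <;> simp_all

theorem rootState_eq_dom : rootState r T J = dom ↔ r ∉ J ∧ ∃ w ∈ J, T.Adj r w := by
  unfold rootState; split_ifs <;> simp_all

theorem rootState_eq_und : rootState r T J = und ↔ r ∉ J ∧ ¬ ∃ w ∈ J, T.Adj r w := by
  unfold rootState; split_ifs <;> simp_all

theorem IsRootedMIS.graft [DecidableEq V] (h₁ : IsRootedMIS K s T₁ J₁) (h₂ : IsRootedMIS L r T₂ J₂)
    (hKL : Disjoint K L) (hτ : comb (rootState s T₁ J₁) (rootState r T₂ J₂) = some τ) :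
    (graft r s T₁ T₂, J₁ ∪ J₂) ∈ RootedMIS (K ∪ L) r τ := by
  have hrs : r ≠ s := fun h =>
    Finset.disjoint_left.1 hKL h₁.tree.root_mem (h ▸ h₂.tree.root_mem)
  rw [Finset.disjoint_left] at hKL
  have hrK : r ∉ K := fun h => hKL h h₂.tree.root_mem
  have hsL : s ∉ L := hKL h₁.tree.root_mem
  have hrJ : r ∉ J₁ := fun h => hrK (h₁.subset h)
  have hsJ : s ∉ J₂ := fun h => hsL (h₂.subset h)
  have hS : rootState r (_root_.graft r s T₁ T₂) (J₁ ∪ J₂) = τ ∧ ¬ (s ∈ J₁ ∧ r ∈ J₂) ∧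
      (s ∉ J₁ → r ∈ J₂ ∨ ∃ w ∈ J₁, T₁.Adj s w) := by
    have hdom : (∃ w ∈ J₁ ∪ J₂, (_root_.graft r s T₁ T₂).Adj r w) ↔
        s ∈ J₁ ∨ ∃ w ∈ J₂, T₂.Adj r w := by
      simp only [graft_adj hrs, Finset.mem_union]
      constructor
      · rintro ⟨w, hw, h | h | h | h⟩
        · exact absurd (h₁.tree.adj_mem _ _ h) hrK
        · refine Or.inr ⟨w, hw.resolve_left fun h' => ?_, h⟩
          exact hKL (h₁.subset h') (h₂.tree.adj_mem_right h)
        · exact Or.inl (by grind)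
        · exact absurd h.1 hrs
      · rintro (h | ⟨w, hw, h⟩)
        · exact ⟨s, Or.inl h, by grind⟩
        · exact ⟨w, Or.inr hw, by grind⟩
    have hsel : r ∈ J₁ ∪ J₂ ↔ r ∈ J₂ := by simp [hrJ]
    rcases h1 : rootState s T₁ J₁ with _ | _ | _ <;> rcases h2 : rootState r T₂ J₂ with _ | _ | _ <;>
      rw [h1, h2] at hτ <;> simp only [comb, Option.some.injEq, reduceCtorEq] at hτ <;> subst hτ <;>
      simp only [rootState_eq_sel, rootState_eq_und, rootState_eq_dom] at h1 h2 ⊢ <;>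
      rw [hsel] <;> (try rw [hdom]) <;> clear hdom hsel <;>
      generalize (∃ w ∈ J₁, T₁.Adj s w) = P at * <;> generalize (∃ w ∈ J₂, T₂.Adj r w) = Q at * <;>
      simp_all
  refine ⟨⟨h₁.tree.graft h₂.tree (Finset.disjoint_left.2 hKL),
    Finset.union_subset_union h₁.subset h₂.subset, ?_, ?_⟩, hS.1⟩
  · intro a ha b hb hab
    have hab : (_root_.graft r s T₁ T₂).Adj a b := hab
    rw [graft_adj hrs] at hab
    rcases hab with h | h | h | h
    · have haK := h₁.tree.adj_mem _ _ h
      have hbK := h₁.tree.adj_mem_right h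
      refine h₁.indep a ?_ b ?_ h
      · exact (Finset.mem_union.1 ha).resolve_right fun h' => hKL haK (h₂.subset h')
      · exact (Finset.mem_union.1 hb).resolve_right fun h' => hKL hbK (h₂.subset h')
    · have haL := h₂.tree.adj_mem _ _ h
      have hbL := h₂.tree.adj_mem_right h
      refine h₂.indep a ?_ b ?_ h
      · exact (Finset.mem_union.1 ha).resolve_left fun h' => hKL (h₁.subset h') haL
      · exact (Finset.mem_union.1 hb).resolve_left fun h' => hKL (h₁.subset h') hbL
    · grind
    · grind
  · intro v hv hvr hvJ
    simp only [Finset.mem_union, not_or] at hvJ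
    simp only [graft_adj hrs, Finset.mem_union]
    rcases Finset.mem_union.1 hv with hv | hv
    · by_cases hvs : v = s
      · subst hvs
        rcases hS.2.2 hvJ.1 with h | ⟨w, hw, h⟩
        · exact ⟨r, Or.inr h, by grind⟩
        · exact ⟨w, Or.inl hw, Or.inl h⟩
      · obtain ⟨w, hw, h⟩ := h₁.dominated v hv hvs hvJ.1
        exact ⟨w, Or.inl hw, Or.inl h⟩
    · obtain ⟨w, hw, h⟩ := h₂.dominated v hv hvr hvJ.2
      exact ⟨w, Or.inr hw, Or.inr (Or.inl h)⟩

theorem exists_graft_of_mem_rootedMIS [DecidableEq V] (h : (T, J) ∈ RootedMIS S r τ) (hv : v ∈ S)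
    (hvr : v ≠ r) :
    ∃ K s T₁ J₁ T₂ J₂, K ⊆ S ∧ v ∈ K ∧ r ∉ K ∧ IsRootedMIS K s T₁ J₁ ∧
      IsRootedMIS (S \ K) r T₂ J₂ ∧ comb (rootState s T₁ J₁) (rootState r T₂ J₂) = some τ ∧
      (T, J) = (graft r s T₁ T₂, J₁ ∪ J₂) := by
  obtain ⟨h, hτ⟩ := h
  obtain ⟨K, s, hKS, hvK, hrK, t₁, t₂, hT⟩ := h.tree.exists_decomposition hv hvr
  have hsK := t₁.root_mem
  have hrs : r ≠ s := fun h => hrK (h ▸ hsK)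
  have hadj := fun a b => (iff_of_eq (congrArg (fun G => G.Adj a b) hT)).trans (graft_adj hrs)
  have hrS := h.tree.root_mem
  have hJ : J = (J ∩ K) ∪ (J ∩ (S \ K)) := by
    have := h.subset
    grind
  have e₁ : ∀ a b, (restrictTo T K).Adj a b ↔ T.Adj a b ∧ a ∈ K ∧ b ∈ K := fun a b => Iff.rfl
  have e₂ : ∀ a b, (restrictTo T (S \ K)).Adj a b ↔ T.Adj a b ∧ a ∈ S \ K ∧ b ∈ S \ K :=
    fun a b => Iff.rfl
  have hrsT : T.Adj r s := by rw [hadj]; grind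
  have i₁ : IsRootedMIS K s (restrictTo T K) (J ∩ K) := by
    refine ⟨t₁, Finset.inter_subset_right, ?_, ?_⟩
    · intro a ha b hb hab
      exact h.indep a (Finset.mem_inter.1 ha).1 b (Finset.mem_inter.1 hb).1 hab.1
    · intro v hv hvs hvJ
      obtain ⟨w, hw, hvw⟩ := h.dominated v (hKS hv) (fun h => hrK (h ▸ hv))
        (fun h => hvJ (Finset.mem_inter.2 ⟨h, hv⟩))
      have hvw' := hvw
      rw [hadj] at hvw'
      have hwK : w ∈ K := by
        have := e₁ v w
        have := e₂ v w
        grind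
      exact ⟨w, Finset.mem_inter.2 ⟨hw, hwK⟩, hvw, hv, hwK⟩
  have i₂ : IsRootedMIS (S \ K) r (restrictTo T (S \ K)) (J ∩ (S \ K)) := by
    refine ⟨t₂, Finset.inter_subset_right, ?_, ?_⟩
    · intro a ha b hb hab
      exact h.indep a (Finset.mem_inter.1 ha).1 b (Finset.mem_inter.1 hb).1 hab.1
    · intro v hv hvr hvJ
      obtain ⟨w, hw, hvw⟩ := h.dominated v (Finset.mem_sdiff.1 hv).1 hvr
        (fun h => hvJ (Finset.mem_inter.2 ⟨h, hv⟩))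
      have hvw' := hvw
      rw [hadj] at hvw'
      have hwK : w ∈ S \ K := by
        have := e₁ v w
        have := e₂ v w
        grind
      exact ⟨w, Finset.mem_inter.2 ⟨hw, hwK⟩, hvw, hv, hwK⟩
  refine ⟨K, s, _, J ∩ K, _, J ∩ (S \ K), hKS, hvK, hrK, i₁, i₂, ?_, Prod.ext hT hJ⟩
  have k₁ : s ∈ J ∩ K ↔ s ∈ J := by simp [hsK]
  have k₂ : r ∈ J ∩ (S \ K) ↔ r ∈ J := by simp [hrK, hrS]
  have hind : ¬ (s ∈ J ∧ r ∈ J) := fun h' => h.indep r h'.2 s h'.1 hrsT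
  have hsdom : s ∉ J → r ∈ J ∨ ∃ w ∈ J ∩ K, (restrictTo T K).Adj s w := by
    intro hs
    obtain ⟨w, hw, hsw⟩ := h.dominated s (hKS hsK) hrs.symm hs
    have hsw' := hsw
    rw [hadj] at hsw'
    have := e₁ s w
    have := e₂ s w
    by_cases hwr : w = r
    · exact Or.inl (hwr ▸ hw)
    · refine Or.inr ⟨w, ?_, ?_⟩ <;> grind
  have hnot : r ∈ J → ¬ ∃ w ∈ J ∩ (S \ K), (restrictTo T (S \ K)).Adj r w := by
    rintro hr ⟨w, hw, hrw⟩
    exact h.indep r hr w (Finset.mem_inter.1 hw).1 hrw.1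
  have hrdom : (∃ w ∈ J, T.Adj r w) ↔
      s ∈ J ∨ ∃ w ∈ J ∩ (S \ K), (restrictTo T (S \ K)).Adj r w := by
    constructor
    · rintro ⟨w, hw, hrw⟩
      have hrw' := hrw
      rw [hadj] at hrw'
      have := e₁ r w
      have := e₂ r w
      by_cases hws : w = s
      · exact Or.inl (hws ▸ hw)
      · refine Or.inr ⟨w, ?_, ?_⟩ <;> grind
    · rintro (hs | ⟨w, hw, hrw⟩)
      · exact ⟨s, hs, hrsT⟩
      · exact ⟨w, (Finset.mem_inter.1 hw).1, hrw.1⟩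
  subst hτ
  suffices key : ∀ a b c, rootState s (restrictTo T K) (J ∩ K) = a →
      rootState r (restrictTo T (S \ K)) (J ∩ (S \ K)) = b → rootState r T J = c →
      comb a b = some c from key _ _ _ rfl rfl rfl
  clear hadj e₁ e₂ i₁ i₂ hT hJ h t₁ t₂
  rintro (_ | _ | _) (_ | _ | _) (_ | _ | _) h1 h2 h3 <;> simp only [comb] <;> exfalso <;>
    simp only [rootState_eq_sel, rootState_eq_und, rootState_eq_dom, k₁, k₂] at h1 h2 h3 <;>
    (try rw [hrdom] at h3) <;> clear hrdom <;>
    generalize (∃ w ∈ J ∩ K, (restrictTo T K).Adj s w) = P at * <;>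
    generalize (∃ w ∈ J ∩ (S \ K), (restrictTo T (S \ K)).Adj r w) = Q at * <;>
    simp_all

theorem graft_rootedMIS_injective [DecidableEq V] {K' : Finset V} {s' : V}
    {T₁' T₂' : SimpleGraph V} {J₁' J₂' : Finset V}
    (h₁ : IsRootedMIS K s T₁ J₁) (h₂ : IsRootedMIS (S \ K) r T₂ J₂)
    (h₁' : IsRootedMIS K' s' T₁' J₁') (h₂' : IsRootedMIS (S \ K') r T₂' J₂')
    (hv : v ∈ K) (hv' : v ∈ K')
    (heq : (graft r s T₁ T₂, J₁ ∪ J₂) = (graft r s' T₁' T₂', J₁' ∪ J₂')) :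
    K = K' ∧ s = s' ∧ (T₁, J₁) = (T₁', J₁') ∧ (T₂, J₂) = (T₂', J₂') := by
  rw [Prod.mk.injEq] at heq
  obtain ⟨rfl, rfl, rfl, rfl⟩ := graft_injective h₁.tree h₂.tree h₁'.tree h₂'.tree hv hv' heq.1
  have a₁ := h₁.subset
  have a₂ := h₂.subset
  have a₁' := h₁'.subset
  have a₂' := h₂'.subset
  refine ⟨rfl, rfl, Prod.ext rfl ?_, Prod.ext rfl ?_⟩
  · ext x
    have := Finset.ext_iff.1 heq.2 x
    grind
  · ext x
    have := Finset.ext_iff.1 heq.2 x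
    grind

end Decomposition

open scoped NNReal ENNReal Nat

/-- Total weight of `RootedMIS S r τ`, each selected vertex having weight `u`. -/
noncomputable def weight {V : Type*} (u : ℝ≥0) (S : Finset V) (r : V) (τ : RootState) : ℝ≥0∞ :=
  ∑' p : RootedMIS S r τ, (u : ℝ≥0∞) ^ p.1.2.card

/-- The pairs of states which combine to `τ`. -/
def combPairs (τ : RootState) : Finset (RootState × RootState) :=
  Finset.univ.filter fun cq => comb cq.1 cq.2 = some τ

theorem mem_combPairs {τ : RootState} {cq : RootState × RootState} :
    cq ∈ combPairs τ ↔ comb cq.1 cq.2 = some τ := by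
  simp [combPairs]

theorem weight_eq_sum {V : Type*} [DecidableEq V] (u : ℝ≥0) (S : Finset V) (r v : V)
    (τ : RootState) (hv : v ∈ S) (hvr : v ≠ r) :
    weight u S r τ = ∑ K ∈ ((S.erase r).erase v).powerset, ∑ s ∈ insert v K,
      ∑ cq ∈ combPairs τ, weight u (insert v K) s cq.1 * weight u (S \ insert v K) r cq.2 := by
  let I := Σ (K : ((S.erase r).erase v).powerset) (s : (insert v K.1 : Finset V))
    (cq : combPairs τ), RootedMIS (insert v K.1) s.1 cq.1.1 × RootedMIS (S \ insert v K.1) r cq.1.2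
  have hI : ∀ i : I, v ∈ insert v i.1.1 ∧ r ∉ insert v i.1.1 ∧ insert v i.1.1 ⊆ S := by
    rintro ⟨⟨K, hK⟩, -⟩
    rw [Finset.mem_powerset] at hK
    refine ⟨Finset.mem_insert_self _ _, ?_, ?_⟩ <;> grind
  have hf : ∀ i : I, (graft r i.2.1.1 i.2.2.2.1.1.1 i.2.2.2.2.1.1,
      i.2.2.2.1.1.2 ∪ i.2.2.2.2.1.2) ∈ RootedMIS S r τ := by
    intro i
    have h := IsRootedMIS.graft (τ := τ) i.2.2.2.1.2.1 i.2.2.2.2.2.1 Finset.disjoint_sdiff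
      (by rw [i.2.2.2.1.2.2, i.2.2.2.2.2.2]; exact mem_combPairs.1 i.2.2.1.2)
    rwa [Finset.union_sdiff_of_subset (hI i).2.2] at h
  let f : I → RootedMIS S r τ := fun i => ⟨_, hf i⟩
  have hbij : Function.Bijective f := by
    constructor
    · intro i i' hii
      have h := graft_rootedMIS_injective i.2.2.2.1.2.1 i.2.2.2.2.2.1 i'.2.2.2.1.2.1 i'.2.2.2.2.2.1
        (hI i).1 (hI i').1 (congrArg Subtype.val hii)
      obtain ⟨⟨K, hK⟩, ⟨s, hs⟩, ⟨⟨c, q⟩, hcq⟩, ⟨p₁, hp₁⟩, ⟨p₂, hp₂⟩⟩ := i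
      obtain ⟨⟨K', hK'⟩, ⟨s', hs'⟩, ⟨⟨c', q'⟩, hcq'⟩, ⟨p₁', hp₁'⟩, ⟨p₂', hp₂'⟩⟩ := i'
      obtain ⟨h1, h2, h3, h4⟩ := h
      simp only at h1 h2 h3 h4
      have hvK : v ∉ K := by
        intro h; exact absurd (Finset.mem_powerset.1 hK h) (Finset.notMem_erase _ _)
      have hvK' : v ∉ K' := by
        intro h; exact absurd (Finset.mem_powerset.1 hK' h) (Finset.notMem_erase _ _)
      obtain rfl : K = K' := by
        rw [← Finset.erase_insert hvK, h1, Finset.erase_insert hvK']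
      obtain rfl : p₁ = p₁' := h3
      obtain rfl : p₂ = p₂' := h4
      subst h2
      obtain rfl : c = c' := hp₁.2.symm.trans hp₁'.2
      obtain rfl : q = q' := hp₂.2.symm.trans hp₂'.2
      rfl
    · rintro ⟨⟨T, J⟩, h⟩
      obtain ⟨K, s, T₁, J₁, T₂, J₂, hKS, hvK, hrK, h₁, h₂, hcomb, heq⟩ :=
        exists_graft_of_mem_rootedMIS h hv hvr
      obtain ⟨K', hvK', rfl⟩ : ∃ K', v ∉ K' ∧ K = insert v K' :=
        ⟨K.erase v, Finset.notMem_erase _ _, (Finset.insert_erase hvK).symm⟩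
      refine ⟨⟨⟨K', ?_⟩, ⟨s, h₁.tree.root_mem⟩,
        ⟨(rootState s T₁ J₁, rootState r T₂ J₂), mem_combPairs.2 hcomb⟩,
        ⟨(T₁, J₁), h₁, rfl⟩, ⟨(T₂, J₂), h₂, rfl⟩⟩, ?_⟩
      · rw [Finset.mem_powerset]
        grind
      · exact Subtype.ext heq.symm
  have hcard : ∀ i : I, (f i).1.2.card = i.2.2.2.1.1.2.card + i.2.2.2.2.1.2.card := by
    intro i
    refine Finset.card_union_of_disjoint ?_
    exact Finset.disjoint_of_subset_left i.2.2.2.1.2.1.subset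
      (Finset.disjoint_of_subset_right i.2.2.2.2.2.1.subset Finset.disjoint_sdiff)
  unfold weight
  rw [← (Equiv.ofBijective f hbij).tsum_eq]
  simp only [Equiv.ofBijective_apply, hcard, pow_add]
  rw [ENNReal.tsum_sigma', ← Finset.tsum_subtype]
  refine tsum_congr fun K => ?_
  rw [ENNReal.tsum_sigma', ← Finset.tsum_subtype]
  refine tsum_congr fun s => ?_
  rw [ENNReal.tsum_sigma', ← Finset.tsum_subtype]
  refine tsum_congr fun cq => ?_
  rw [ENNReal.tsum_prod']
  simp only [ENNReal.tsum_mul_left, ENNReal.tsum_mul_right]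

/-- The weight of rooted trees on `n + 1` vertices. -/
noncomputable def treeWeight (u : ℝ≥0) : ℕ → RootState → ℝ≥0
  | 0, sel => u
  | 0, und => 1
  | 0, dom => 0
  | n + 1, τ => ∑ k : Fin (n + 1), (n.choose k : ℝ≥0) * ((k + 1) * ∑ cq ∈ combPairs τ,
      treeWeight u k cq.1 * treeWeight u (n - k) cq.2)
  termination_by n => n

theorem weight_singleton {V : Type*} [DecidableEq V] (u : ℝ≥0) (r : V) (τ : RootState) :
    weight u {r} r τ = treeWeight u 0 τ := by
  have hT : ∀ T J, IsRootedMIS {r} r T J → T = ⊥ := by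
    intro T J h
    ext a b
    simp only [SimpleGraph.bot_adj, iff_false]
    intro hab
    have h1 := h.tree.adj_mem _ _ hab
    have h2 := h.tree.adj_mem_right hab
    rw [Finset.mem_singleton] at h1 h2
    exact hab.ne (h1.trans h2.symm)
  have htree : IsTreeOn {r} r (⊥ : SimpleGraph V) :=
    ⟨SimpleGraph.isAcyclic_bot, by simp, by
      intro v hv; rw [Finset.mem_singleton.1 hv], by simp⟩
  have hmis : ∀ J ⊆ {r}, IsRootedMIS {r} r (⊥ : SimpleGraph V) J :=
    fun J hJ => ⟨htree, hJ, by simp, by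
      intro v hv hvr; exact absurd (Finset.mem_singleton.1 hv) hvr⟩
  have hset : (RootedMIS {r} r τ : Set (SimpleGraph V × Finset V)) =
      match τ with
      | sel => {(⊥, {r})}
      | und => {(⊥, ∅)}
      | dom => ∅ := by
    ext ⟨T, J⟩
    cases τ
    · simp only [RootedMIS, rootState_eq_sel, Set.mem_ofPred_eq, Set.mem_singleton_iff,
        Prod.mk.injEq]
      constructor
      · rintro ⟨h, hr⟩
        refine ⟨hT _ _ h, Finset.Subset.antisymm h.subset (by simpa using hr)⟩
      · rintro ⟨rfl, rfl⟩
        exact ⟨hmis _ subset_rfl, by simp⟩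
    · simp only [RootedMIS, rootState_eq_und, Set.mem_ofPred_eq, Set.mem_singleton_iff,
        Prod.mk.injEq]
      constructor
      · rintro ⟨h, hr, -⟩
        refine ⟨hT _ _ h, ?_⟩
        have := h.subset
        grind
      · rintro ⟨rfl, rfl⟩
        exact ⟨hmis _ (by simp), by simp⟩
    · simp only [RootedMIS, rootState_eq_dom, Set.mem_ofPred_eq, Set.mem_empty_iff_false, iff_false]
      rintro ⟨h, -, w, -, hw⟩
      rw [hT _ _ h] at hw
      exact hw
  unfold weight
  rw [hset]
  cases τ <;> simp [treeWeight]

theorem weight_eq_treeWeight {V : Type*} [DecidableEq V] (u : ℝ≥0) (n : ℕ) :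
    ∀ (S : Finset V) (r : V) (τ : RootState), r ∈ S → S.card = n + 1 →
      weight u S r τ = treeWeight u n τ := by
  induction n using Nat.strong_induction_on with
  | _ n ih =>
    intro S r τ hr hS
    obtain _ | n := n
    · obtain ⟨a, rfl⟩ := Finset.card_eq_one.1 hS
      obtain rfl := Finset.mem_singleton.1 hr
      exact weight_singleton u r τ
    · obtain ⟨v, hv⟩ : ∃ v, v ∈ S.erase r := by
        rw [← Finset.Nonempty, ← Finset.card_pos, Finset.card_erase_of_mem hr]; omega
      have hvS := Finset.mem_of_mem_erase hv
      have hvr := Finset.ne_of_mem_erase hv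
      have hcard : ((S.erase r).erase v).card = n := by
        rw [Finset.card_erase_of_mem hv, Finset.card_erase_of_mem hr]; omega
      rw [weight_eq_sum u S r v τ hvS hvr, treeWeight]
      let g : ℕ → ℝ≥0∞ := fun k => (((k + 1) * ∑ cq ∈ combPairs τ,
        treeWeight u k cq.1 * treeWeight u (n - k) cq.2 : ℝ≥0) : ℝ≥0∞)
      have hterm : ∀ K ∈ ((S.erase r).erase v).powerset, (∑ s ∈ insert v K,
          ∑ cq ∈ combPairs τ, weight u (insert v K) s cq.1 * weight u (S \ insert v K) r cq.2) =
          g K.card := by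
        intro K hK
        rw [Finset.mem_powerset] at hK
        have hvK : v ∉ K := fun h => absurd (hK h) (Finset.notMem_erase _ _)
        have hKn : K.card ≤ n := hcard ▸ Finset.card_le_card hK
        have hc := Finset.card_insert_of_notMem hvK
        have hsub : insert v K ⊆ S := by grind
        have hrK : r ∉ insert v K := by grind
        have hc' : (S \ insert v K).card = n - K.card + 1 := by
          rw [Finset.card_sdiff_of_subset hsub]; omega
        have : ∀ s ∈ insert v K, (∑ cq ∈ combPairs τ,
            weight u (insert v K) s cq.1 * weight u (S \ insert v K) r cq.2) =
            ((∑ cq ∈ combPairs τ, treeWeight u K.card cq.1 * treeWeight u (n - K.card) cq.2 : ℝ≥0) :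
              ℝ≥0∞) := by
          intro s hs
          push_cast
          refine Finset.sum_congr rfl fun cq _ => ?_
          rw [ih K.card (by omega) _ s cq.1 hs hc, ih (n - K.card) (by omega) _ r cq.2
            (Finset.mem_sdiff.2 ⟨hr, hrK⟩) hc']
        rw [Finset.sum_congr rfl this, Finset.sum_const, hc]
        push_cast
        rw [nsmul_eq_mul]
        simp only [g]
        push_cast
        rfl
      rw [Finset.sum_congr rfl hterm, Finset.sum_powerset_apply_card, hcard,
        Finset.sum_range]
      push_cast
      simp only [nsmul_eq_mul, g]
      push_cast
      rfl

/-- Coefficients of the exponential generating function of `treeWeight`. -/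
noncomputable def treeCoeff (u : ℝ≥0) (n : ℕ) (τ : RootState) : ℝ := treeWeight u n τ / n !

theorem treeCoeff_nonneg (u : ℝ≥0) (n : ℕ) (τ : RootState) : 0 ≤ treeCoeff u n τ := by
  unfold treeCoeff; positivity

theorem treeCoeff_succ (u : ℝ≥0) (n : ℕ) (τ : RootState) :
    (n + 1) * treeCoeff u (n + 1) τ = ∑ k ∈ Finset.range (n + 1), (k + 1) *
      ∑ cq ∈ combPairs τ, treeCoeff u k cq.1 * treeCoeff u (n - k) cq.2 := by
  unfold treeCoeff
  rw [treeWeight, Finset.sum_range]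
  push_cast
  rw [Finset.sum_div, Finset.mul_sum]
  refine Finset.sum_congr rfl fun k _ => ?_
  have hk : (k : ℕ) ≤ n := Nat.lt_succ_iff.1 k.2
  have hc : ((n.choose k : ℕ) : ℝ) = n ! / (k ! * (n - k)!) := by
    rw [Nat.choose_eq_factorial_div_factorial hk,
      Nat.cast_div (Nat.factorial_mul_factorial_dvd_factorial hk) (by positivity)]
    push_cast
    rfl
  simp only [Finset.mul_sum, Finset.sum_div]
  refine Finset.sum_congr rfl fun cq _ => ?_
  rw [hc, Nat.factorial_succ]
  push_cast
  field_simp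

theorem treeCoeff_zero (u : ℝ≥0) : treeCoeff u 0 sel = u ∧ treeCoeff u 0 und = 1 ∧
    treeCoeff u 0 dom = 0 := by
  simp [treeCoeff, treeWeight]

theorem combPairs_sel : combPairs sel = {(und, sel), (dom, sel)} := by decide

theorem combPairs_und : combPairs und = {(dom, und)} := by decide

theorem combPairs_dom : combPairs dom = {(sel, und), (sel, dom), (dom, dom)} := by decide

theorem treeCoeff_succ_sel (u : ℝ≥0) (n : ℕ) :
    (n + 1) * treeCoeff u (n + 1) sel = ∑ k ∈ Finset.range (n + 1), (k + 1) *
      ((treeCoeff u k und + treeCoeff u k dom) * treeCoeff u (n - k) sel) := by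
  rw [treeCoeff_succ, combPairs_sel]
  refine Finset.sum_congr rfl fun k _ => ?_
  rw [Finset.sum_pair (by decide)]
  ring

theorem treeCoeff_succ_und (u : ℝ≥0) (n : ℕ) :
    (n + 1) * treeCoeff u (n + 1) und = ∑ k ∈ Finset.range (n + 1), (k + 1) *
      (treeCoeff u k dom * treeCoeff u (n - k) und) := by
  rw [treeCoeff_succ, combPairs_und]
  simp

theorem treeCoeff_succ_dom (u : ℝ≥0) (n : ℕ) :
    (n + 1) * treeCoeff u (n + 1) dom = ∑ k ∈ Finset.range (n + 1), (k + 1) *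
      (treeCoeff u k sel * treeCoeff u (n - k) und +
        (treeCoeff u k sel + treeCoeff u k dom) * treeCoeff u (n - k) dom) := by
  rw [treeCoeff_succ, combPairs_dom]
  refine Finset.sum_congr rfl fun k _ => ?_
  rw [Finset.sum_insert (by decide), Finset.sum_pair (by decide)]
  ring

theorem isMaximalIndepSet_iff {V : Type*} {G : SimpleGraph V} {J : Set V} :
    IsMaximalIndepSet G J ↔ IsIndepSet G J ∧ ∀ v ∉ J, ∃ w ∈ J, G.Adj v w := by
  refine and_congr_right fun hJ => ⟨fun h v hv => ?_, fun h J' hJ' hlt => ?_⟩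
  · by_contra! hno
    refine h (insert v J) ?_ (Set.ssubset_insert hv)
    rintro a b (rfl | ha) (rfl | hb)
    · exact G.loopless.irrefl _
    · exact hno b hb
    · exact fun hab => hno a ha hab.symm
    · exact hJ ha hb
  · obtain ⟨v, hv, hvJ⟩ := Set.exists_of_ssubset hlt
    obtain ⟨w, hw, hvw⟩ := h v hvJ
    exact hJ' hv (hlt.subset hw) hvw

theorem SimpleGraph.IsAcyclic.map_embedding {V W : Type*} {G : SimpleGraph V} (h : G.IsAcyclic)
    (e : V ↪ W) : (G.map e).IsAcyclic := by
  rw [SimpleGraph.isAcyclic_iff_forall_adj_isBridge] at h ⊢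
  rintro x y hxy
  obtain ⟨a, b, hab, rfl, rfl⟩ := (SimpleGraph.map_adj _ _ _ _).1 hxy
  have hb := h hab
  rw [SimpleGraph.isBridge_iff] at hb ⊢
  intro hreach
  obtain ⟨c, hc, hr⟩ := SimpleGraph.Reachable.induction_on_adj
    (P := fun w => ∃ c, w = e c ∧ (G.deleteEdges {s(a, b)}).Reachable a c)
    hreach ⟨a, rfl, .rfl⟩ (by
      rintro _ y - ⟨c, rfl, hc⟩ hxy
      rw [SimpleGraph.deleteEdges_adj] at hxy
      obtain ⟨c', d, hcd, he, rfl⟩ := (SimpleGraph.map_adj _ _ _ _).1 hxy.1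
      obtain rfl := e.injective he
      refine ⟨d, rfl, hc.trans (SimpleGraph.Adj.reachable ?_)⟩
      rw [SimpleGraph.deleteEdges_adj]
      refine ⟨hcd, ?_⟩
      have := hxy.2
      simpa using this)
  obtain rfl := e.injective hc
  exact hb hr

/-- A forest with a maximal independent set extends to a tree on one more vertex, which is joined to
the independent set. -/
theorem exists_rootedMIS_extension {n : ℕ} (F : SimpleGraph (Fin n)) (J : Finset (Fin n))
    (hF : F.IsAcyclic) (hJ : IsMaximalIndepSet F (J : Set (Fin n))) :
    ∃ T : SimpleGraph (Option (Fin n)), T.comap Option.some = F ∧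
      (T, J.map Function.Embedding.some) ∈
        RootedMIS Finset.univ none und ∪ RootedMIS Finset.univ none dom := by
  classical
  rw [isMaximalIndepSet_iff] at hJ
  let G : SimpleGraph (Option (Fin n)) := F.map Function.Embedding.some ⊔
    SimpleGraph.fromRel fun a b => a = none ∧ ∃ j ∈ J, b = some j
  obtain ⟨T, hHT, hTG, hT, hreach⟩ := SimpleGraph.exists_isAcyclic_reachable_eq_le_of_le_of_isAcyclic
    (H := F.map Function.Embedding.some) (G := G) le_sup_left (hF.map_embedding _)
  have hGadj : ∀ a b, G.Adj (some a) (some b) ↔ F.Adj a b := by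
    intro a b
    have h : G.Adj (some a) (some b) ↔ (F.map Function.Embedding.some).Adj (some a) (some b) := by
      simp [G]
    exact h.trans (SimpleGraph.map_adj_apply (f := Function.Embedding.some))
  have hFT : ∀ a b, F.Adj a b → T.Adj (some a) (some b) := fun a b hab =>
    hHT ((SimpleGraph.map_adj _ _ _ _).2 ⟨a, b, hab, rfl, rfl⟩)
  have hTF : ∀ a b, T.Adj (some a) (some b) ↔ F.Adj a b := fun a b =>
    ⟨fun h => (hGadj a b).1 (hTG h), hFT a b⟩
  have hG : ∀ j ∈ J, G.Adj none (some j) := by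
    intro j hj
    simp [G, hj]
  have hnone : none ∉ J.map Function.Embedding.some := by simp
  have hmis : IsRootedMIS Finset.univ none T (J.map Function.Embedding.some) := by
    refine ⟨⟨hT, fun _ _ _ => Finset.mem_univ _, ?_, Finset.mem_univ _⟩, Finset.subset_univ _, ?_, ?_⟩
    · intro v _
      rw [hreach]
      obtain _ | v := v
      · rfl
      · by_cases hv : v ∈ J
        · exact (hG v hv).reachable
        · obtain ⟨w, hw, hvw⟩ := hJ.2 v hv
          exact (hG w hw).reachable.trans ((hGadj w v).2 hvw.symm).reachable
    · intro a ha b hb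
      obtain ⟨a, ha', rfl⟩ := Finset.mem_map.1 ha
      obtain ⟨b, hb', rfl⟩ := Finset.mem_map.1 hb
      exact fun hab => hJ.1 ha' hb' ((hTF a b).1 hab)
    · intro v _ hv hvJ
      obtain _ | v := v
      · exact absurd rfl hv
      · obtain ⟨w, hw, hvw⟩ := hJ.2 v fun h => hvJ (Finset.mem_map.2 ⟨v, h, rfl⟩)
        exact ⟨some w, Finset.mem_map.2 ⟨w, hw, rfl⟩, hFT v w hvw⟩
  refine ⟨T, ?_, ?_⟩
  · ext a b
    exact hTF a b
  · rcases h : rootState none T (J.map Function.Embedding.some) with _ | _ | _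
    · exact absurd (rootState_eq_sel.1 h) hnone
    · exact Or.inl ⟨hmis, h⟩
    · exact Or.inr ⟨hmis, h⟩

noncomputable instance (n : ℕ) : Fintype (MISpace n) := by
  unfold MISpace
  exact Fintype.ofFinite _

/-- The total weight of the pairs in `MISpace n`, each vertex of the independent set having weight
`u`. -/
noncomputable def misWeight (u : ℝ≥0) (n : ℕ) : ℝ≥0 := ∑ p : MISpace n, u ^ p.val.2.ncard

theorem misWeight_le (u : ℝ≥0) (n : ℕ) :
    misWeight u n ≤ treeWeight u n und + treeWeight u n dom := by
  classical
  have hex : ∀ p : MISpace n, ∃ T : SimpleGraph (Option (Fin n)), T.comap Option.some = p.1.1 ∧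
      (T, p.1.2.toFinset.map Function.Embedding.some) ∈
        RootedMIS Finset.univ none und ∪ RootedMIS Finset.univ none dom := fun p =>
    exists_rootedMIS_extension p.1.1 p.1.2.toFinset p.2.1 (by simpa using p.2.2)
  choose T hT hmem using hex
  let f : MISpace n → (RootedMIS Finset.univ none und ∪ RootedMIS Finset.univ none dom :
    Set (SimpleGraph (Option (Fin n)) × Finset (Option (Fin n)))) := fun p => ⟨_, hmem p⟩
  have hf : Function.Injective f := by
    intro p p' h
    have h := congrArg Subtype.val h
    simp only [f, Prod.mk.injEq, Finset.map_inj, Set.toFinset_inj] at h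
    refine Subtype.ext (Prod.ext ?_ h.2)
    rw [← hT p, ← hT p', h.1]
  have hcard : (Finset.univ : Finset (Option (Fin n))).card = n + 1 := by simp
  rw [← ENNReal.coe_le_coe]
  push_cast
  rw [← weight_eq_treeWeight u n Finset.univ none und (Finset.mem_univ _) hcard,
    ← weight_eq_treeWeight u n Finset.univ none dom (Finset.mem_univ _) hcard]
  refine le_trans ?_ (ENNReal.tsum_union_le
    (fun p : SimpleGraph (Option (Fin n)) × Finset (Option (Fin n)) => (u : ℝ≥0∞) ^ p.2.card) _ _)
  refine le_trans (le_of_eq ?_) (ENNReal.tsum_comp_le_tsum_of_injective hf _)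
  rw [misWeight, tsum_fintype]
  push_cast
  refine Finset.sum_congr rfl fun p _ => ?_
  simp [f, Set.ncard_eq_toFinset_card']

theorem le_misWeight (u : ℝ≥0) (n : ℕ) : treeWeight u n sel ≤ misWeight u (n + 1) := by
  classical
  have hcard : (Finset.univ : Finset (Fin (n + 1))).card = n + 1 := by simp
  have hmis : ∀ p ∈ RootedMIS (Finset.univ : Finset (Fin (n + 1))) 0 sel,
      p.1.IsAcyclic ∧ IsMaximalIndepSet p.1 (p.2 : Set (Fin (n + 1))) := by
    rintro ⟨T, J⟩ ⟨h, hs⟩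
    refine ⟨h.tree.acyclic, isMaximalIndepSet_iff.2 ⟨fun a b ha hb => h.indep a ha b hb, ?_⟩⟩
    intro v hv
    refine h.dominated v (Finset.mem_univ _) ?_ hv
    rintro rfl
    exact hv (rootState_eq_sel.1 hs)
  let f : RootedMIS (Finset.univ : Finset (Fin (n + 1))) 0 sel → MISpace (n + 1) :=
    fun p => ⟨(p.1.1, p.1.2), hmis p.1 p.2⟩
  have hf : Function.Injective f := by
    intro p p' h
    have h := congrArg Subtype.val h
    simp only [f, Prod.mk.injEq, Finset.coe_inj] at h
    exact Subtype.ext (Prod.ext h.1 h.2)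
  rw [← ENNReal.coe_le_coe, ← weight_eq_treeWeight u n Finset.univ 0 sel (Finset.mem_univ _) hcard]
  have : ((misWeight u (n + 1) : ℝ≥0) : ℝ≥0∞) =
      ∑' p : MISpace (n + 1), (u : ℝ≥0∞) ^ p.val.2.ncard := by
    rw [misWeight, tsum_fintype]
    push_cast
    rfl
  rw [this]
  refine le_trans (le_of_eq ?_) (ENNReal.tsum_comp_le_tsum_of_injective hf _)
  refine tsum_congr fun p => ?_
  simp [f, Set.ncard_eq_toFinset_card']

theorem iN_eq_misWeight (n : ℕ) : (iN n : ℝ) = misWeight 1 n := by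
  simp [iN, misWeight]

/-- Jensen's inequality for the size of the independent set. -/
theorem exp_mul_En_le {n : ℕ} (hn : 0 < misWeight 1 n) (t : ℝ) :
    Real.exp (t * En n) * misWeight 1 n ≤ misWeight (Real.exp t).toNNReal n := by
  have hpos : (0 : ℝ) < iN n := by rw [iN_eq_misWeight]; exact_mod_cast hn
  have hN : (iN n : ℝ) = Fintype.card (MISpace n) := by simp [iN]
  have hE : ∑ p : MISpace n, (p.val.2.ncard : ℝ) = En n * iN n := by
    rw [En, finsum_eq_sum_of_fintype, div_mul_cancel₀ _ hpos.ne']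
  have hW : (misWeight (Real.exp t).toNNReal n : ℝ) =
      ∑ p : MISpace n, Real.exp (t * p.val.2.ncard) := by
    rw [misWeight]
    push_cast
    refine Finset.sum_congr rfl fun p _ => ?_
    rw [Real.coe_toNNReal _ (Real.exp_pos t).le, ← Real.exp_nat_mul, mul_comm]
  rw [hW, ← iN_eq_misWeight]
  calc Real.exp (t * En n) * iN n
      = ∑ p : MISpace n, Real.exp (t * En n) * (t * p.val.2.ncard - t * En n + 1) := by
        rw [← Finset.mul_sum, Finset.sum_add_distrib, Finset.sum_sub_distrib, ← Finset.mul_sum, hE]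
        simp only [Finset.sum_const, Finset.card_univ, nsmul_eq_mul, ← hN]
        ring
    _ ≤ ∑ p : MISpace n, Real.exp (t * p.val.2.ncard) := by
        refine Finset.sum_le_sum fun p _ => ?_
        have := mul_le_mul_of_nonneg_left (Real.add_one_le_exp (t * p.val.2.ncard - t * En n))
          (Real.exp_pos (t * En n)).le
        rwa [← Real.exp_add, add_sub_cancel] at this

theorem nonneg_of_hasDerivAt_ge {f f' E E' : ℝ → ℝ} {x : ℝ} (hx : 0 ≤ x)
    (hf : ∀ z ∈ Set.Icc 0 x, HasDerivAt f (f' z) z) (hE : ∀ z ∈ Set.Icc 0 x, HasDerivAt E (E' z) z)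
    (h : ∀ z ∈ Set.Icc 0 x, E' z * f z ≤ f' z) (h0 : 0 ≤ f 0) : 0 ≤ f x := by
  have hder : ∀ z ∈ Set.Icc 0 x, HasDerivAt (fun z => f z * Real.exp (-E z))
      (f' z * Real.exp (-E z) + f z * (Real.exp (-E z) * -E' z)) z := fun z hz =>
    (hf z hz).mul (hE z hz).neg.exp
  have hmono : MonotoneOn (fun z => f z * Real.exp (-E z)) (Set.Icc 0 x) := by
    refine monotoneOn_of_hasDerivWithinAt_nonneg (convex_Icc 0 x)
      (fun z hz => (hder z hz).continuousAt.continuousWithinAt)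
      (fun z hz => (hder z (interior_subset hz)).hasDerivWithinAt) ?_
    intro z hz
    have := h z (interior_subset hz)
    have := Real.exp_pos (-E z)
    nlinarith
  have := hmono (Set.left_mem_Icc.2 hx) (Set.right_mem_Icc.2 hx) hx
  have h1 : 0 ≤ f 0 * Real.exp (-E 0) := by positivity
  exact nonneg_of_mul_nonneg_left (h1.trans this) (Real.exp_pos _)

/-- The `N`-th partial sum of the power series with coefficients `a`. -/
def partialSum (a : ℕ → ℝ) (N : ℕ) (z : ℝ) : ℝ := ∑ n ∈ Finset.range N, a n * z ^ n

section PartialSum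

variable {a b c : ℕ → ℝ} {N : ℕ} {z : ℝ}

theorem hasDerivAt_partialSum_succ (a : ℕ → ℝ) (N : ℕ) (z : ℝ) :
    HasDerivAt (partialSum a (N + 1)) (partialSum (fun n => (n + 1) * a (n + 1)) N z) z := by
  have h : ∀ n ∈ Finset.range (N + 1),
      HasDerivAt (fun z => a n * z ^ n) (a n * (n * z ^ (n - 1))) z :=
    fun n _ => (hasDerivAt_pow n z).const_mul (a n)
  have := HasDerivAt.fun_sum h
  refine this.congr_deriv ?_
  rw [Finset.sum_range_succ', partialSum]
  simp only [Nat.cast_zero, zero_mul, mul_zero, add_zero, Nat.cast_add, Nat.cast_one,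
    Nat.add_sub_cancel]
  exact Finset.sum_congr rfl fun n _ => by ring

theorem hasDerivAt_mul_partialSum (a : ℕ → ℝ) (N : ℕ) (z : ℝ) :
    HasDerivAt (fun z => z * partialSum a N z) (partialSum (fun n => (n + 1) * a n) N z) z := by
  have h : ∀ n ∈ Finset.range N,
      HasDerivAt (fun z => a n * z ^ (n + 1)) (a n * ((n + 1 : ℕ) * z ^ n)) z :=
    fun n _ => (hasDerivAt_pow (n + 1) z).const_mul (a n)
  have := HasDerivAt.fun_sum h
  refine (this.congr_deriv ?_).congr_of_eventuallyEq (Eventually.of_forall fun w => ?_)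
  · exact Finset.sum_congr rfl fun n _ => by push_cast; ring
  · simp only [partialSum, Finset.mul_sum]
    exact Finset.sum_congr rfl fun n _ => by ring

theorem partialSum_nonneg (ha : ∀ n, 0 ≤ a n) (hz : 0 ≤ z) (N : ℕ) : 0 ≤ partialSum a N z :=
  Finset.sum_nonneg fun n _ => mul_nonneg (ha n) (pow_nonneg hz n)

theorem partialSum_convolution_le (ha : ∀ n, 0 ≤ a n) (hb : ∀ n, 0 ≤ b n) (hz : 0 ≤ z)
    (hc : ∀ n, c n = ∑ k ∈ Finset.range (n + 1), a k * b (n - k)) (N : ℕ) :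
    partialSum c N z ≤ partialSum a N z * partialSum b (N + 1) z := by
  have h1 : partialSum c N z = ∑ p ∈ (Finset.range N).sigma fun n => Finset.range (n + 1),
      (a p.2 * z ^ p.2) * (b (p.1 - p.2) * z ^ (p.1 - p.2)) := by
    rw [Finset.sum_sigma, partialSum]
    refine Finset.sum_congr rfl fun n _ => ?_
    rw [hc, Finset.sum_mul]
    refine Finset.sum_congr rfl fun k hk => ?_
    have hk : k ≤ n := Nat.lt_succ_iff.1 (Finset.mem_range.1 hk)
    rw [← Nat.add_sub_of_le hk, pow_add, Nat.add_sub_cancel_left]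
    ring
  rw [h1, partialSum, partialSum, Finset.sum_mul_sum, ← Finset.sum_product']
  have hinj : Set.InjOn (fun p : Σ _ : ℕ, ℕ => (p.2, p.1 - p.2))
      ((Finset.range N).sigma fun n => Finset.range (n + 1) : Finset (Σ _ : ℕ, ℕ)) := by
    rintro ⟨n, k⟩ hp ⟨n', k'⟩ hp' heq
    simp only [Finset.coe_sigma, Set.mem_sigma_iff, Finset.mem_coe, Finset.mem_range,
      Prod.mk.injEq] at hp hp' heq
    obtain ⟨rfl, h⟩ := heq
    obtain rfl : n = n' := by omega
    rfl
  rw [← Finset.sum_image (g := fun p : Σ _ : ℕ, ℕ => (p.2, p.1 - p.2))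
    (f := fun q : ℕ × ℕ => (a q.1 * z ^ q.1) * (b q.2 * z ^ q.2)) hinj]
  refine Finset.sum_le_sum_of_subset_of_nonneg ?_ ?_
  · intro q hq
    simp only [Finset.mem_image, Finset.mem_sigma, Finset.mem_range, Sigma.exists] at hq
    obtain ⟨n, k, ⟨hn, hk⟩, rfl⟩ := hq
    simp only [Finset.mem_product, Finset.mem_range]
    omega
  · intro q _ _
    have := ha q.1
    have := hb q.2
    positivity

theorem partialSum_add (a b : ℕ → ℝ) (N : ℕ) (z : ℝ) :
    partialSum (fun n => a n + b n) N z = partialSum a N z + partialSum b N z := by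
  simp [partialSum, add_mul, Finset.sum_add_distrib]

theorem partialSum_zero_right (a : ℕ → ℝ) (N : ℕ) : partialSum a (N + 1) 0 = a 0 := by
  simp [partialSum, Finset.sum_range_succ']

end PartialSum

section UpperBound

variable (u : ℝ≥0) (N : ℕ) {z : ℝ}

theorem partialSum_und_le (hz : 0 ≤ z) : partialSum (treeCoeff u · und) (N + 1) z ≤
    Real.exp (z * partialSum (treeCoeff u · dom) N z) := by
  rw [← sub_nonneg]
  refine nonneg_of_hasDerivAt_ge (E := fun z => z * partialSum (treeCoeff u · dom) N z)
    (f := fun z => Real.exp (z * partialSum (treeCoeff u · dom) N z) -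
      partialSum (treeCoeff u · und) (N + 1) z) hz
    (fun w _ => (hasDerivAt_mul_partialSum _ N w).exp.sub (hasDerivAt_partialSum_succ _ N w))
    (fun w _ => hasDerivAt_mul_partialSum _ N w) ?_ ?_
  · rintro w ⟨hw, -⟩
    have h := partialSum_convolution_le (N := N) (z := w)
      (a := fun n => (n + 1) * treeCoeff u n dom) (b := fun n => treeCoeff u n und)
      (c := fun n => (n + 1) * treeCoeff u (n + 1) und)
      (fun n => mul_nonneg (by positivity) (treeCoeff_nonneg _ _ _))
      (fun n => treeCoeff_nonneg _ _ _) hw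
      (fun n => by rw [treeCoeff_succ_und]; exact Finset.sum_congr rfl fun k _ => by ring)
    linarith
  · simp [partialSum_zero_right, treeCoeff_zero]

theorem partialSum_sel_le (hz : 0 ≤ z) : partialSum (treeCoeff u · sel) (N + 1) z ≤
    u * Real.exp (z * partialSum (fun n => treeCoeff u n und + treeCoeff u n dom) N z) := by
  rw [← sub_nonneg]
  refine nonneg_of_hasDerivAt_ge
    (E := fun z => z * partialSum (fun n => treeCoeff u n und + treeCoeff u n dom) N z)
    (f := fun z =>
      u * Real.exp (z * partialSum (fun n => treeCoeff u n und + treeCoeff u n dom) N z) -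
      partialSum (treeCoeff u · sel) (N + 1) z) hz
    (fun w _ => ((hasDerivAt_mul_partialSum _ N w).exp.const_mul _).sub
      (hasDerivAt_partialSum_succ _ N w))
    (fun w _ => hasDerivAt_mul_partialSum _ N w) ?_ ?_
  · rintro w ⟨hw, -⟩
    have h := partialSum_convolution_le (N := N) (z := w)
      (a := fun n => (n + 1) * (treeCoeff u n und + treeCoeff u n dom))
      (b := fun n => treeCoeff u n sel)
      (c := fun n => (n + 1) * treeCoeff u (n + 1) sel)
      (fun n => mul_nonneg (by positivity)
        (add_nonneg (treeCoeff_nonneg _ _ _) (treeCoeff_nonneg _ _ _)))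
      (fun n => treeCoeff_nonneg _ _ _) hw
      (fun n => by rw [treeCoeff_succ_sel]; exact Finset.sum_congr rfl fun k _ => by ring)
    linarith
  · simp [partialSum_zero_right, treeCoeff_zero]

theorem partialSum_dom_le (hz : 0 ≤ z) : partialSum (treeCoeff u · dom) (N + 1) z ≤
    (Real.exp (z * partialSum (treeCoeff u · sel) N z) - 1) *
      Real.exp (z * partialSum (treeCoeff u · dom) N z) := by
  rw [← sub_nonneg]
  refine nonneg_of_hasDerivAt_ge
    (E := fun z => z * partialSum (treeCoeff u · sel) N z + z * partialSum (treeCoeff u · dom) N z)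
    (f := fun z => (Real.exp (z * partialSum (treeCoeff u · sel) N z) - 1) *
      Real.exp (z * partialSum (treeCoeff u · dom) N z) - partialSum (treeCoeff u · dom) (N + 1) z) hz
    (fun w _ => (((hasDerivAt_mul_partialSum _ N w).exp.sub_const 1).mul
      (hasDerivAt_mul_partialSum _ N w).exp).sub (hasDerivAt_partialSum_succ _ N w))
    (fun w _ => (hasDerivAt_mul_partialSum _ N w).add (hasDerivAt_mul_partialSum _ N w)) ?_ ?_
  · rintro w ⟨hw, -⟩
    have hp : ∀ (n : ℕ) (τ : RootState), 0 ≤ ((n : ℝ) + 1) * treeCoeff u n τ :=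
      fun n τ => mul_nonneg (by positivity) (treeCoeff_nonneg _ _ _)
    have h1 := partialSum_convolution_le (N := N) (z := w)
      (a := fun n => (n + 1) * treeCoeff u n sel) (b := fun n => treeCoeff u n und)
      (fun n => hp n sel) (fun n => treeCoeff_nonneg _ _ _) hw (fun n => rfl)
    have h2 := partialSum_convolution_le (N := N) (z := w)
      (a := fun n => (n + 1) * treeCoeff u n sel + (n + 1) * treeCoeff u n dom)
      (b := fun n => treeCoeff u n dom)
      (fun n => add_nonneg (hp n sel) (hp n dom)) (fun n => treeCoeff_nonneg _ _ _) hw (fun n => rfl)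
    have h3 : partialSum (fun n => (n + 1) * treeCoeff u (n + 1) dom) N w = _ :=
      (congrArg (fun f => partialSum f N w) (funext fun n => by
        rw [treeCoeff_succ_dom, ← Finset.sum_add_distrib]
        exact Finset.sum_congr rfl fun k _ => by ring)).trans (partialSum_add
          (fun n => ∑ k ∈ Finset.range (n + 1), (k + 1) * treeCoeff u k sel * treeCoeff u (n - k) und)
          (fun n => ∑ k ∈ Finset.range (n + 1), ((k + 1) * treeCoeff u k sel +
            (k + 1) * treeCoeff u k dom) * treeCoeff u (n - k) dom) N w)
    have h4 := mul_le_mul_of_nonneg_left (partialSum_und_le u N hw)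
      (partialSum_nonneg (fun n => hp n sel) hw N)
    rw [partialSum_add] at h2
    nlinarith
  · simp [partialSum_zero_right, treeCoeff_zero]

theorem partialSum_le_of_fixedPoint {y x : ℝ} (hy : 0 < y)
    (hx : x = y * Real.exp (-(y * (Real.exp (u * y * Real.exp y) - 1)))) :
    x * partialSum (treeCoeff u · und) N x ≤ y ∧
    x * partialSum (treeCoeff u · sel) N x ≤ u * y * Real.exp y ∧
    x * partialSum (treeCoeff u · dom) N x ≤ y * (Real.exp (u * y * Real.exp y) - 1) := by
  have hx0 : 0 < x := by rw [hx]; positivity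
  have hA : 0 ≤ u * y * Real.exp y := by positivity
  have hA1 : 1 ≤ Real.exp (u * y * Real.exp y) := Real.one_le_exp hA
  set A := u * y * Real.exp y with hAdef
  set D := y * (Real.exp A - 1) with hD
  have hD0 : 0 ≤ D := mul_nonneg hy.le (by linarith)
  have hxD : x * Real.exp D = y := by
    rw [hx, mul_assoc, ← Real.exp_add]; simp
  induction N with
  | zero => simp only [partialSum, Finset.range_zero, Finset.sum_empty, mul_zero]; exact ⟨hy.le, hA, hD0⟩
  | succ N ih =>
    obtain ⟨ih1, ih2, ih3⟩ := ih
    refine ⟨?_, ?_, ?_⟩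
    · calc _ ≤ x * Real.exp D := mul_le_mul_of_nonneg_left
            ((partialSum_und_le u N hx0.le).trans (Real.exp_le_exp.2 ih3)) hx0.le
        _ = y := hxD
    · calc _ ≤ x * (u * Real.exp (y + D)) := mul_le_mul_of_nonneg_left
            ((partialSum_sel_le u N hx0.le).trans (mul_le_mul_of_nonneg_left
              (Real.exp_le_exp.2 (by rw [partialSum_add]; linarith)) u.2)) hx0.le
        _ = u * (x * Real.exp D) * Real.exp y := by rw [Real.exp_add]; ring
        _ = A := by rw [hxD]
    · calc _ ≤ x * ((Real.exp A - 1) * Real.exp D) := mul_le_mul_of_nonneg_left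
            ((partialSum_dom_le u N hx0.le).trans (mul_le_mul
              (sub_le_sub_right (Real.exp_le_exp.2 ih2) 1) (Real.exp_le_exp.2 ih3)
              (Real.exp_pos _).le (by linarith))) hx0.le
        _ = (x * Real.exp D) * (Real.exp A - 1) := by ring
        _ = D := by rw [hxD]

theorem und_add_dom_le {y x : ℝ} (hy : 0 < y)
    (hx : x = y * Real.exp (-(y * (Real.exp (u * y * Real.exp y) - 1)))) (n : ℕ) :
    (treeCoeff u n und + treeCoeff u n dom) * x ^ (n + 1) ≤ y * Real.exp (u * y * Real.exp y) := by
  have hx0 : 0 < x := by rw [hx]; positivity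
  obtain ⟨h1, -, h3⟩ := partialSum_le_of_fixedPoint u (n + 1) hy hx
  have hle : ∀ τ, treeCoeff u n τ * x ^ n ≤ partialSum (treeCoeff u · τ) (n + 1) x := fun τ =>
    Finset.single_le_sum (f := fun n => treeCoeff u n τ * x ^ n)
      (fun k _ => mul_nonneg (treeCoeff_nonneg u k τ) (by positivity))
      (Finset.self_mem_range_succ n)
  have h4 := mul_le_mul_of_nonneg_left (hle und) hx0.le
  have h5 := mul_le_mul_of_nonneg_left (hle dom) hx0.le
  calc _ = x * (treeCoeff u n und * x ^ n) + x * (treeCoeff u n dom * x ^ n) := by ring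
    _ ≤ y + y * (Real.exp (u * y * Real.exp y) - 1) := by linarith
    _ = _ := by ring

end UpperBound

/-- The sum of the power series with coefficients `a`. -/
noncomputable def powerSum (a : ℕ → ℝ) (z : ℝ) : ℝ := ∑' n, a n * z ^ n

section PowerSum

variable {a b c : ℕ → ℝ} {C κ z : ℝ}

theorem summable_norm_powerSum (hκ : 0 < κ) (ha : ∀ n, |a n| ≤ C * κ ^ n) (hz : |z| * κ < 1) :
    Summable fun n => ‖a n * z ^ n‖ := by
  have h : Summable fun n : ℕ => C * (|z| * κ) ^ n :=
    (summable_geometric_of_lt_one (by positivity) hz).mul_left C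
  refine Summable.of_nonneg_of_le (fun n => norm_nonneg _) (fun n => ?_) h
  rw [norm_mul, norm_pow, Real.norm_eq_abs, Real.norm_eq_abs, mul_pow]
  calc |a n| * |z| ^ n ≤ C * κ ^ n * |z| ^ n := by gcongr; exact ha n
    _ = _ := by ring

theorem summable_norm_powerSum_succ_mul (hκ : 0 < κ) (ha : ∀ n, |a n| ≤ C * κ ^ n)
    (hz : |z| * κ < 1) : Summable fun n : ℕ => ‖((n : ℝ) + 1) * a n * z ^ n‖ := by
  have hr : ‖|z| * κ‖ < 1 := by rwa [Real.norm_of_nonneg (by positivity)]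
  have h : Summable fun n : ℕ => C * ((n : ℝ) ^ 1 * (|z| * κ) ^ n + (|z| * κ) ^ n) :=
    ((summable_pow_mul_geometric_of_norm_lt_one 1 hr).add
      (summable_geometric_of_norm_lt_one hr)).mul_left C
  refine Summable.of_nonneg_of_le (fun n => norm_nonneg _) (fun n => ?_) h
  rw [norm_mul, norm_mul, norm_pow, Real.norm_eq_abs, Real.norm_eq_abs, Real.norm_eq_abs, mul_pow,
    abs_of_nonneg (by positivity : (0 : ℝ) ≤ n + 1)]
  calc (n + 1 : ℝ) * |a n| * |z| ^ n ≤ (n + 1 : ℝ) * (C * κ ^ n) * |z| ^ n := by gcongr; exact ha n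
    _ = _ := by ring

theorem hasDerivAt_powerSum (hκ : 0 < κ) (ha : ∀ n, |a n| ≤ C * κ ^ n) (hz : |z| * κ < 1) :
    HasDerivAt (powerSum a) (powerSum (fun n => (n + 1) * a (n + 1)) z) z := by
  obtain ⟨r, hr1, hr2⟩ := exists_between ((lt_div_iff₀ hκ).2 hz)
  have hr0 : 0 < r := (abs_nonneg z).trans_lt hr1
  rw [lt_div_iff₀ hκ] at hr2
  have hnr : ‖r * κ‖ < 1 := by rwa [Real.norm_of_nonneg (by positivity)]
  have hs : Summable fun n : ℕ => C / r * ((n : ℝ) ^ 1 * (r * κ) ^ n) :=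
    (summable_pow_mul_geometric_of_norm_lt_one 1 hnr).mul_left _
  have hbound : ∀ (n : ℕ) (y : ℝ), y ∈ Metric.ball (0 : ℝ) r →
      ‖a n * (n * y ^ (n - 1))‖ ≤ C / r * ((n : ℝ) ^ 1 * (r * κ) ^ n) := by
    intro n y hy
    rw [mem_ball_zero_iff, Real.norm_eq_abs] at hy
    rcases n with - | n
    · simp
    · rw [norm_mul, norm_mul, norm_pow, Real.norm_eq_abs, Real.norm_eq_abs, Real.norm_eq_abs,
        abs_of_nonneg (by positivity : (0 : ℝ) ≤ (n + 1 : ℕ)), Nat.add_sub_cancel]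
      calc |a (n + 1)| * ((n + 1 : ℕ) * |y| ^ n)
          ≤ C * κ ^ (n + 1) * ((n + 1 : ℕ) * r ^ n) := by
            gcongr
            · exact (abs_nonneg _).trans (ha _)
            · exact ha _
        _ = _ := by field_simp; ring
  have h := hasDerivAt_tsum_of_isPreconnected hs Metric.isOpen_ball
    (convex_ball (0 : ℝ) r).isPreconnected
    (fun n y _ => (hasDerivAt_pow n y).const_mul (a n)) hbound (Metric.mem_ball_self hr0)
    (summable_norm_powerSum (z := 0) hκ ha (by simp)).of_norm
    (show z ∈ Metric.ball (0 : ℝ) r by simpa using hr1)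
  refine h.congr_deriv ?_
  have hsum : Summable fun n : ℕ => a n * (n * z ^ (n - 1)) :=
    Summable.of_norm_bounded hs fun n => hbound n z (by simpa using hr1)
  rw [hsum.tsum_eq_zero_add, powerSum]
  simp only [Nat.cast_zero, zero_mul, mul_zero, zero_add, Nat.cast_add, Nat.cast_one,
    Nat.add_sub_cancel]
  exact tsum_congr fun n => by ring

theorem hasDerivAt_mul_powerSum (hκ : 0 < κ) (ha : ∀ n, |a n| ≤ C * κ ^ n) (hz : |z| * κ < 1) :
    HasDerivAt (fun z => z * powerSum a z) (powerSum (fun n => (n + 1) * a n) z) z := by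
  have h := (hasDerivAt_id z).mul (hasDerivAt_powerSum hκ ha hz)
  refine h.congr_deriv ?_
  have h1 := (summable_norm_powerSum_succ_mul hκ ha hz).of_norm
  have h2 := (summable_norm_powerSum hκ ha hz).of_norm
  have h3 : Summable fun n : ℕ => (n : ℝ) * a n * z ^ n := (h1.sub h2).congr fun n => by ring
  have h4 : powerSum (fun n => (n + 1) * a n) z = powerSum a z + ∑' n : ℕ, (n : ℝ) * a n * z ^ n := by
    rw [powerSum, powerSum, ← h2.tsum_add h3]
    exact tsum_congr fun n => by ring
  rw [h4, h3.tsum_eq_zero_add, powerSum, powerSum, id]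
  simp only [Nat.cast_zero, zero_mul, one_mul, zero_add, Nat.cast_add, Nat.cast_one]
  rw [← tsum_mul_left]
  congr 1
  exact tsum_congr fun n => by ring

theorem powerSum_add (ha : Summable fun n => ‖a n * z ^ n‖) (hb : Summable fun n => ‖b n * z ^ n‖) :
    powerSum (fun n => a n + b n) z = powerSum a z + powerSum b z := by
  rw [powerSum, powerSum, powerSum, ← ha.of_norm.tsum_add hb.of_norm]
  exact tsum_congr fun n => by ring

theorem convolution_mul_pow (hc : ∀ n, c n = ∑ k ∈ Finset.range (n + 1), a k * b (n - k)) (n : ℕ) :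
    c n * z ^ n = ∑ k ∈ Finset.range (n + 1), a k * z ^ k * (b (n - k) * z ^ (n - k)) := by
  rw [hc, Finset.sum_mul]
  refine Finset.sum_congr rfl fun k hk => ?_
  have hk : k ≤ n := Nat.lt_succ_iff.1 (Finset.mem_range.1 hk)
  rw [show z ^ n = z ^ k * z ^ (n - k) by rw [← pow_add, Nat.add_sub_of_le hk]]
  ring

theorem powerSum_convolution (ha : Summable fun n => ‖a n * z ^ n‖)
    (hb : Summable fun n => ‖b n * z ^ n‖)
    (hc : ∀ n, c n = ∑ k ∈ Finset.range (n + 1), a k * b (n - k)) :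
    powerSum c z = powerSum a z * powerSum b z := by
  rw [powerSum, powerSum, powerSum, tsum_mul_tsum_eq_tsum_sum_range_of_summable_norm ha hb]
  exact tsum_congr (convolution_mul_pow hc)

theorem summable_norm_convolution (ha : Summable fun n => ‖a n * z ^ n‖)
    (hb : Summable fun n => ‖b n * z ^ n‖)
    (hc : ∀ n, c n = ∑ k ∈ Finset.range (n + 1), a k * b (n - k)) :
    Summable fun n => ‖c n * z ^ n‖ := by
  simpa only [convolution_mul_pow hc] using summable_norm_sum_mul_range_of_summable_norm ha hb

theorem powerSum_zero (a : ℕ → ℝ) : powerSum a 0 = a 0 := by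
  rw [powerSum, tsum_eq_single 0 fun n hn => by simp [hn]]
  simp

end PowerSum

theorem eq_zero_of_hasDerivAt_eq {f f' E E' : ℝ → ℝ} {x : ℝ} (hx : 0 ≤ x)
    (hf : ∀ z ∈ Set.Icc 0 x, HasDerivAt f (f' z) z) (hE : ∀ z ∈ Set.Icc 0 x, HasDerivAt E (E' z) z)
    (h : ∀ z ∈ Set.Icc 0 x, f' z = E' z * f z) (h0 : f 0 = 0) : f x = 0 := by
  refine le_antisymm ?_ (nonneg_of_hasDerivAt_ge hx hf hE (fun z hz => (h z hz).ge) h0.ge)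
  have := nonneg_of_hasDerivAt_ge (f := fun z => -f z) (f' := fun z => -f' z) hx
    (fun z hz => (hf z hz).neg) hE (fun z hz => by rw [h z hz]; simp) (by simp [h0])
  linarith

section LowerBound

theorem not_treeCoeff_le_pow {ρ κ : ℝ}
    (hρ : ∀ y : ℝ, 0 < y → y * Real.exp (-(y * (Real.exp (y * Real.exp y) - 1))) ≤ ρ)
    (hκ : 0 < κ) (hκρ : κ * ρ < 1) : ¬ ∃ C : ℝ, ∀ n τ, treeCoeff 1 n τ ≤ C * κ ^ n := by
  rintro ⟨C, hC⟩
  have hρ0 : 0 < ρ := (by positivity : (0 : ℝ) < 1 * Real.exp _).trans_le (hρ 1 one_pos)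
  obtain ⟨z, hz1, hz2⟩ := exists_between ((lt_div_iff₀' hκ).2 hκρ)
  have hz0 : 0 < z := hρ0.trans hz1
  rw [lt_div_iff₀ hκ] at hz2
  have habs : ∀ τ n, |treeCoeff 1 n τ| ≤ C * κ ^ n := fun τ n => by
    rw [abs_of_nonneg (treeCoeff_nonneg _ _ _)]; exact hC n τ
  have hlt : ∀ w ∈ Set.Icc 0 z, |w| * κ < 1 := fun w hw => by
    rw [abs_of_nonneg hw.1]
    exact (mul_le_mul_of_nonneg_right hw.2 hκ.le).trans_lt hz2
  set P : RootState → ℝ → ℝ := fun τ => powerSum (treeCoeff 1 · τ) with hP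
  set P' : RootState → ℝ → ℝ := fun τ => powerSum fun n => (n + 1) * treeCoeff 1 (n + 1) τ with hP'
  set Q : RootState → ℝ → ℝ := fun τ => powerSum fun n => (n + 1) * treeCoeff 1 n τ with hQ
  have hPd : ∀ τ, ∀ w ∈ Set.Icc 0 z, HasDerivAt (P τ) (P' τ w) w := fun τ w hw =>
    hasDerivAt_powerSum hκ (habs τ) (hlt w hw)
  have hQd : ∀ τ, ∀ w ∈ Set.Icc 0 z, HasDerivAt (fun w => w * P τ w) (Q τ w) w := fun τ w hw =>
    hasDerivAt_mul_powerSum hκ (habs τ) (hlt w hw)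
  have hs : ∀ τ, ∀ w ∈ Set.Icc 0 z, Summable fun n => ‖treeCoeff 1 n τ * w ^ n‖ := fun τ w hw =>
    summable_norm_powerSum hκ (habs τ) (hlt w hw)
  have hs' : ∀ τ, ∀ w ∈ Set.Icc 0 z, Summable fun n : ℕ => ‖(n + 1) * treeCoeff 1 n τ * w ^ n‖ :=
    fun τ w hw => summable_norm_powerSum_succ_mul hκ (habs τ) (hlt w hw)
  have hadd : ∀ τ τ', ∀ w ∈ Set.Icc 0 z, powerSum
      (fun n => (n + 1) * treeCoeff 1 n τ + (n + 1) * treeCoeff 1 n τ') w = Q τ w + Q τ' w :=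
    fun τ τ' w hw => powerSum_add (hs' τ w hw) (hs' τ' w hw)
  have hsadd : ∀ τ τ', ∀ w ∈ Set.Icc 0 z, Summable fun n : ℕ =>
      ‖((n + 1) * treeCoeff 1 n τ + (n + 1) * treeCoeff 1 n τ') * w ^ n‖ := fun τ τ' w hw =>
    ((hs' τ w hw).add (hs' τ' w hw)).of_nonneg_of_le (fun n => norm_nonneg _) fun n => by
      rw [add_mul]; exact norm_add_le _ _
  have hund' : ∀ w ∈ Set.Icc 0 z, P' und w = Q dom w * P und w := fun w hw =>
    powerSum_convolution (hs' dom w hw) (hs und w hw) fun n => by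
      rw [treeCoeff_succ_und]; exact Finset.sum_congr rfl fun k _ => by ring
  have hsel' : ∀ w ∈ Set.Icc 0 z, P' sel w = (Q und w + Q dom w) * P sel w := fun w hw => by
    rw [← hadd und dom w hw]
    exact powerSum_convolution (hsadd und dom w hw) (hs sel w hw) fun n => by
      rw [treeCoeff_succ_sel]; exact Finset.sum_congr rfl fun k _ => by ring
  have hdom' : ∀ w ∈ Set.Icc 0 z,
      P' dom w = Q sel w * P und w + (Q sel w + Q dom w) * P dom w := fun w hw => by
    rw [← hadd sel dom w hw, ← powerSum_convolution (hs' sel w hw) (hs und w hw) fun n => rfl,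
      ← powerSum_convolution (hsadd sel dom w hw) (hs dom w hw) fun n => rfl, ← powerSum_add
      (summable_norm_convolution (hs' sel w hw) (hs und w hw) fun n => rfl)
      (summable_norm_convolution (hsadd sel dom w hw) (hs dom w hw) fun n => rfl)]
    refine congrArg (fun f => powerSum f w) (funext fun n => ?_)
    rw [treeCoeff_succ_dom, ← Finset.sum_add_distrib]
    exact Finset.sum_congr rfl fun k _ => by ring
  have hund : ∀ w ∈ Set.Icc 0 z, P und w = Real.exp (w * P dom w) := fun w hw => by
    have hsub : ∀ v ∈ Set.Icc 0 w, v ∈ Set.Icc 0 z := fun v hv => ⟨hv.1, hv.2.trans hw.2⟩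
    rw [← sub_eq_zero]
    refine eq_zero_of_hasDerivAt_eq (f := fun w => P und w - Real.exp (w * P dom w)) hw.1
      (fun v hv => (hPd und v (hsub v hv)).sub (hQd dom v (hsub v hv)).exp)
      (fun v hv => hQd dom v (hsub v hv)) (fun v hv => ?_) ?_
    · simp only [hund' v (hsub v hv)]; ring
    · simp [hP, powerSum_zero, treeCoeff_zero]
  have hzz : z ∈ Set.Icc 0 z := ⟨hz0.le, le_rfl⟩
  have hsel : P sel z = Real.exp (z * P und z + z * P dom z) := by
    rw [← sub_eq_zero]
    refine eq_zero_of_hasDerivAt_eq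
      (f := fun w => P sel w - Real.exp (w * P und w + w * P dom w)) hz0.le
      (fun v hv => (hPd sel v hv).sub ((hQd und v hv).add (hQd dom v hv)).exp)
      (fun v hv => (hQd und v hv).add (hQd dom v hv)) (fun v hv => ?_) ?_
    · simp only [hsel' v hv, Pi.add_apply]; ring
    · simp [hP, powerSum_zero, treeCoeff_zero]
  have hdom : P dom z = (Real.exp (z * P sel z) - 1) * Real.exp (z * P dom z) := by
    rw [← sub_eq_zero]
    refine eq_zero_of_hasDerivAt_eq
      (f := fun w => P dom w - (Real.exp (w * P sel w) - 1) * Real.exp (w * P dom w)) hz0.le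
      (fun v hv => (hPd dom v hv).sub (((hQd sel v hv).exp.sub_const 1).mul (hQd dom v hv).exp))
      (fun v hv => (hQd sel v hv).add (hQd dom v hv)) (fun v hv => ?_) ?_
    · simp only [hdom' v hv, hund v hv]; ring
    · simp [hP, powerSum_zero, treeCoeff_zero]
  have hU := hund z hzz
  set Y := z * P und z with hY
  set D := z * P dom z with hD
  have hY0 : 0 < Y := by rw [hY, hU]; positivity
  have hA : z * P sel z = Y * Real.exp Y := by
    rw [hsel, Real.exp_add, ← hU, hY]; ring
  have hDY : D = Y * (Real.exp (Y * Real.exp Y) - 1) := by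
    rw [hD, hdom, hA, ← hU, hY]; ring
  have hzY : Y * Real.exp (-D) = z := by
    rw [hY, hU, mul_assoc, ← Real.exp_add]; simp
  have := hρ Y hY0
  rw [← hDY, hzY] at this
  linarith

theorem und_add_dom_le_sel_succ (n : ℕ) :
    treeCoeff 1 n und + treeCoeff 1 n dom ≤ treeCoeff 1 (n + 1) sel := by
  have h := treeCoeff_succ_sel 1 n
  have h0 : ∀ n τ, 0 ≤ treeCoeff 1 n τ := treeCoeff_nonneg 1
  have h1 := Finset.single_le_sum (f := fun k : ℕ => ((k : ℝ) + 1) *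
    ((treeCoeff 1 k und + treeCoeff 1 k dom) * treeCoeff 1 (n - k) sel))
    (fun k _ => mul_nonneg (by positivity) (mul_nonneg (add_nonneg (h0 _ _) (h0 _ _)) (h0 _ _)))
    (Finset.self_mem_range_succ n)
  rw [← h, Nat.sub_self, (treeCoeff_zero 1).1, NNReal.coe_one, mul_one] at h1
  exact le_of_mul_le_mul_left h1 (by positivity)

theorem mul_sel_mul_le_dom_succ (n k : ℕ) (hk : k ≤ n) : (k + 1) * (treeCoeff 1 k sel *
    (treeCoeff 1 (n - k) und + treeCoeff 1 (n - k) dom)) ≤ (n + 1) * treeCoeff 1 (n + 1) dom := by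
  have h0 : ∀ n τ, 0 ≤ treeCoeff 1 n τ := treeCoeff_nonneg 1
  rw [treeCoeff_succ_dom]
  refine le_trans ?_ (Finset.single_le_sum (f := fun k : ℕ => ((k : ℝ) + 1) *
    (treeCoeff 1 k sel * treeCoeff 1 (n - k) und +
      (treeCoeff 1 k sel + treeCoeff 1 k dom) * treeCoeff 1 (n - k) dom))
    (fun k _ => mul_nonneg (by positivity) (add_nonneg (mul_nonneg (h0 _ _) (h0 _ _))
      (mul_nonneg (add_nonneg (h0 _ _) (h0 _ _)) (h0 _ _))))
    (Finset.mem_range.2 (Nat.lt_succ_iff.2 hk)))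
  refine mul_le_mul_of_nonneg_left ?_ (by positivity)
  nlinarith [mul_nonneg (h0 k dom) (h0 (n - k) dom)]

theorem sel_le_dom_succ (n : ℕ) : treeCoeff 1 n sel ≤ treeCoeff 1 (n + 1) dom := by
  have h := mul_sel_mul_le_dom_succ n n le_rfl
  rw [Nat.sub_self, (treeCoeff_zero 1).2.1, (treeCoeff_zero 1).2.2, add_zero, mul_one] at h
  exact le_of_mul_le_mul_left h (by positivity)

theorem sel_mul_sel_le (n m : ℕ) :
    treeCoeff 1 n sel * treeCoeff 1 m sel / 2 ≤ treeCoeff 1 (n + m + 3) sel := by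
  wlog h : m ≤ n generalizing n m
  · have := this m n (by omega)
    rwa [mul_comm, Nat.add_comm n m]
  have h0 : ∀ n τ, 0 ≤ treeCoeff 1 n τ := treeCoeff_nonneg 1
  have h1 := mul_sel_mul_le_dom_succ (n + m + 1) n (by omega)
  rw [show n + m + 1 - n = m + 1 by omega] at h1
  have h2 := sel_le_dom_succ m
  have h3 := und_add_dom_le_sel_succ (n + m + 2)
  have h4 : treeCoeff 1 n sel * treeCoeff 1 m sel ≤
      treeCoeff 1 n sel * (treeCoeff 1 (m + 1) und + treeCoeff 1 (m + 1) dom) :=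
    mul_le_mul_of_nonneg_left (by linarith [h0 (m + 1) und]) (h0 _ _)
  have h5 : (n + m + 2 : ℝ) ≤ 2 * (n + 1) := by
    have : (m : ℝ) ≤ n := Nat.cast_le.2 h
    linarith
  have h6 : (n + 1 : ℝ) * (treeCoeff 1 n sel * treeCoeff 1 m sel) ≤
      (n + 1) * (2 * treeCoeff 1 (n + m + 2) dom) := by
    calc _ ≤ _ := mul_le_mul_of_nonneg_left h4 (by positivity)
      _ ≤ _ := h1
      _ = (n + m + 2 : ℝ) * treeCoeff 1 (n + m + 2) dom := by push_cast; ring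
      _ ≤ 2 * (n + 1) * treeCoeff 1 (n + m + 2) dom := mul_le_mul_of_nonneg_right h5 (h0 _ _)
      _ = _ := by ring
  have h7 := le_of_mul_le_mul_left h6 (by positivity)
  have := h0 (n + m + 2) und
  linarith

theorem treeCoeff_sel_pos (n : ℕ) : 0 < treeCoeff 1 n sel := by
  induction n using Nat.strong_induction_on with
  | _ n ih =>
    match n, ih with
    | 0, _ => rw [(treeCoeff_zero 1).1]; simp
    | 1, _ =>
      have := und_add_dom_le_sel_succ 0
      rw [(treeCoeff_zero 1).2.1, (treeCoeff_zero 1).2.2] at this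
      linarith
    | n + 2, ih =>
      have h1 := und_add_dom_le_sel_succ (n + 1)
      have h2 := sel_le_dom_succ n
      have h3 := ih n (by omega)
      have h4 := treeCoeff_nonneg 1 (n + 1) und
      linarith

theorem exists_pow_le_treeCoeff_sel {ρ κ : ℝ}
    (hρ : ∀ y : ℝ, 0 < y → y * Real.exp (-(y * (Real.exp (y * Real.exp y) - 1))) ≤ ρ)
    (hκ : 0 < κ) (hκρ : κ * ρ < 1) : ∃ c > 0, ∀ n, c * κ ^ n ≤ treeCoeff 1 n sel := by
  obtain ⟨m, hm⟩ : ∃ m, 2 * κ ^ (m + 3) ≤ treeCoeff 1 m sel := by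
    by_contra! hcon
    refine not_treeCoeff_le_pow hρ hκ hκρ ⟨2 * κ ^ 3 * (1 + κ), fun n τ => ?_⟩
    have h1 := hcon n
    have h2 := hcon (n + 1)
    have h3 := und_add_dom_le_sel_succ n
    have h4 := treeCoeff_nonneg 1 n und
    have h5 := treeCoeff_nonneg 1 n dom
    have h6 : (0 : ℝ) < κ ^ (n + 3) := by positivity
    have h7 : (0 : ℝ) < κ ^ (n + 1 + 3) := by positivity
    have h8 : 2 * κ ^ 3 * (1 + κ) * κ ^ n = 2 * κ ^ (n + 3) + 2 * κ ^ (n + 1 + 3) := by ring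
    rw [h8]
    cases τ <;> linarith
  obtain ⟨i, -, hi⟩ := Finset.exists_min_image (Finset.range (m + 3))
    (fun n => treeCoeff 1 n sel / κ ^ n) ⟨0, by simp⟩
  refine ⟨treeCoeff 1 i sel / κ ^ i, div_pos (treeCoeff_sel_pos i) (by positivity), fun n => ?_⟩
  induction n using Nat.strong_induction_on with
  | _ n ih =>
    rcases lt_or_ge n (m + 3) with h | h
    · exact (le_div_iff₀ (by positivity)).1 (hi n (Finset.mem_range.2 h))
    · obtain ⟨k, rfl⟩ := Nat.exists_eq_add_of_le' h
      have h1 := ih k (by omega)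
      have h2 := sel_mul_sel_le k m
      have h3 := mul_le_mul h1 hm (by positivity) (treeCoeff_sel_pos k).le
      rw [← add_assoc]
      refine le_trans (le_of_eq ?_) ((div_le_div_of_nonneg_right h3 two_pos.le).trans h2)
      ring

end LowerBound

section Radius

theorem hasDerivAt_exp_mul_exp (y : ℝ) : HasDerivAt (fun y => Real.exp (y * Real.exp y))
    (Real.exp (y * Real.exp y) * ((1 + y) * Real.exp y)) y :=
  ((hasDerivAt_id y).mul (Real.hasDerivAt_exp y)).exp.congr_deriv (by simp; ring)

theorem hasDerivAt_radius (y : ℝ) :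
    HasDerivAt (fun y => y * Real.exp (-(y * (Real.exp (y * Real.exp y) - 1))))
      (Real.exp (-(y * (Real.exp (y * Real.exp y) - 1))) *
        (1 - (y * (Real.exp (y * Real.exp y) - 1) +
          y ^ 2 * (1 + y) * Real.exp y * Real.exp (y * Real.exp y)))) y :=
  ((hasDerivAt_id y).mul ((hasDerivAt_id y).mul
    ((hasDerivAt_exp_mul_exp y).sub_const 1)).neg.exp).congr_deriv (by simp; ring)

theorem sum_le_exp_le {x : ℝ} (h0 : 0 ≤ x) (h1 : x ≤ 1) :
    ∑ m ∈ Finset.range 11, x ^ m / m ! ≤ Real.exp x ∧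
      Real.exp x ≤ ∑ m ∈ Finset.range 11, x ^ m / m ! + x ^ 11 * (11 + 1) / (11 ! * 11) :=
  ⟨Real.sum_le_exp_of_nonneg h0 11, by simpa using Real.exp_bound' h0 h1 (n := 11) (by norm_num)⟩

theorem exists_maximal_radius : ∃ y₀ : ℝ, 0 < y₀ ∧
    (∀ y : ℝ, 0 < y → y * Real.exp (-(y * (Real.exp (y * Real.exp y) - 1))) ≤
      y₀ * Real.exp (-(y₀ * (Real.exp (y₀ * Real.exp y₀) - 1)))) ∧
    0.46392 < y₀ ^ 2 * Real.exp y₀ * Real.exp (y₀ * Real.exp y₀) ∧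
    y₀ ^ 2 * Real.exp y₀ * Real.exp (y₀ * Real.exp y₀) < 0.46393 := by
  set K : ℝ → ℝ := fun y => y * (Real.exp (y * Real.exp y) - 1) +
    y ^ 2 * (1 + y) * Real.exp y * Real.exp (y * Real.exp y) with hK
  have hKmono : MonotoneOn K (Set.Ici 0) := by
    intro a ha b hb hab
    simp only [Set.mem_Ici] at ha hb
    have : 1 ≤ Real.exp (a * Real.exp a) := Real.one_le_exp (by positivity)
    have hab' : Real.exp (a * Real.exp a) ≤ Real.exp (b * Real.exp b) := by gcongr
    simp only [hK]
    gcongr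
  have exp_le : ∀ {x w e : ℝ}, 0 ≤ x → x ≤ w → w ≤ 1 →
      ∑ m ∈ Finset.range 11, w ^ m / m ! + w ^ 11 * (11 + 1) / (11 ! * 11) ≤ e →
      Real.exp x ≤ e := fun h0 hxw hw he =>
    (Real.exp_le_exp.2 hxw).trans ((sum_le_exp_le (h0.trans hxw) hw).2.trans he)
  have le_exp : ∀ {x w e : ℝ}, 0 ≤ w → w ≤ x → w ≤ 1 →
      e ≤ ∑ m ∈ Finset.range 11, w ^ m / m ! → e ≤ Real.exp x := fun h0 hxw hw he =>
    (he.trans (sum_le_exp_le h0 hw).1).trans (Real.exp_le_exp.2 hxw)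
  have h1 : 1.5044416 ≤ Real.exp 0.4084218 := le_exp (w := 0.4084218)
    (by norm_num) le_rfl (by norm_num) (by norm_num [Finset.sum_range_succ, Nat.factorial])
  have h2 : Real.exp 0.4084218 ≤ 1.504441602 := exp_le (w := 0.4084218)
    (by norm_num) le_rfl (by norm_num) (by norm_num [Finset.sum_range_succ, Nat.factorial])
  have h3 : 1.8486335 ≤ Real.exp (0.4084218 * Real.exp 0.4084218) := le_exp (w := 0.61444674)
    (by norm_num) (by linarith) (by norm_num) (by norm_num [Finset.sum_range_succ, Nat.factorial])
  have h4 : Real.exp (0.4084218 * Real.exp 0.4084218) ≤ 1.8486337 := exp_le (w := 0.6144468)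
    (by positivity) (by linarith) (by norm_num) (by norm_num [Finset.sum_range_succ, Nat.factorial])
  have h5 : 1.5044437 ≤ Real.exp 0.4084232 := le_exp (w := 0.4084232)
    (by norm_num) le_rfl (by norm_num) (by norm_num [Finset.sum_range_succ, Nat.factorial])
  have h6 : Real.exp 0.4084232 ≤ 1.50444371 := exp_le (w := 0.4084232)
    (by norm_num) le_rfl (by norm_num) (by norm_num [Finset.sum_range_succ, Nat.factorial])
  have h7 : 1.848639 ≤ Real.exp (0.4084232 * Real.exp 0.4084232) := le_exp (w := 0.6144497)
    (by norm_num) (by linarith) (by norm_num) (by norm_num [Finset.sum_range_succ, Nat.factorial])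
  have h8 : Real.exp (0.4084232 * Real.exp 0.4084232) ≤ 1.8486392 := exp_le (w := 0.61444975)
    (by positivity) (by linarith) (by norm_num) (by norm_num [Finset.sum_range_succ, Nat.factorial])
  have hlo : K 0.4084218 ≤ 1 := by
    have := mul_le_mul h2 h4 (Real.exp_pos _).le (by norm_num)
    simp only [hK]
    linarith
  have hhi : 1 ≤ K 0.4084232 := by
    have := mul_le_mul h5 h7 (by norm_num) (Real.exp_pos _).le
    simp only [hK]
    linarith
  have hKc : ContinuousOn K (Set.Icc 0.4084218 0.4084232) := by
    simp only [hK]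
    fun_prop
  obtain ⟨y₀, ⟨hy1, hy2⟩, hy⟩ := intermediate_value_Icc (by norm_num) hKc ⟨hlo, hhi⟩
  have hy0 : 0 < y₀ := lt_of_lt_of_le (by norm_num) hy1
  refine ⟨y₀, hy0, fun y hy' => ?_, ?_, ?_⟩
  · rcases le_total y y₀ with h | h
    · refine monotoneOn_of_hasDerivWithinAt_nonneg (convex_Icc y y₀)
        (fun z _ => (hasDerivAt_radius z).continuousAt.continuousWithinAt)
        (fun z _ => (hasDerivAt_radius z).hasDerivWithinAt) (fun z hz => ?_)
        (Set.left_mem_Icc.2 h) (Set.right_mem_Icc.2 h) h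
      have hz := interior_subset hz
      refine mul_nonneg (Real.exp_pos _).le (sub_nonneg.2 ?_)
      exact (hKmono (hy'.le.trans hz.1) hy0.le hz.2).trans hy.le
    · refine antitoneOn_of_hasDerivWithinAt_nonpos (convex_Icc y₀ y)
        (fun z _ => (hasDerivAt_radius z).continuousAt.continuousWithinAt)
        (fun z _ => (hasDerivAt_radius z).hasDerivWithinAt) (fun z hz => ?_)
        (Set.left_mem_Icc.2 h) (Set.right_mem_Icc.2 h) h
      have hz := interior_subset hz
      refine mul_nonpos_of_nonneg_of_nonpos (Real.exp_pos _).le (sub_nonpos.2 ?_)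
      exact hy.ge.trans (hKmono hy0.le (hy0.le.trans hz.1) hz.1)
  · calc (0.46392 : ℝ) < 0.4084218 ^ 2 * 1.5044416 * 1.8486335 := by norm_num
      _ ≤ 0.4084218 ^ 2 * Real.exp 0.4084218 * Real.exp (0.4084218 * Real.exp 0.4084218) := by gcongr
      _ ≤ _ := by gcongr
  · calc _ ≤ 0.4084232 ^ 2 * Real.exp 0.4084232 *
          Real.exp (0.4084232 * Real.exp 0.4084232) := by gcongr
      _ ≤ 0.4084232 ^ 2 * 1.50444371 * 1.8486392 := by gcongr
      _ < 0.46393 := by norm_num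

end Radius

section Limit

theorem exp_mul_En_succ_mul_le {y c κ x : ℝ} (hy : 0 < y) (hc : 0 < c) (hκ : 0 < κ)
    (hsel : ∀ n, c * κ ^ n ≤ treeCoeff 1 n sel) (t : ℝ)
    (hx : x = y * Real.exp (-(y * (Real.exp (Real.exp t * y * Real.exp y) - 1)))) (n : ℕ) :
    Real.exp (t * En (n + 1)) * (c * κ ^ n) * x ^ (n + 2) ≤
      (n + 1) * (y * Real.exp (Real.exp t * y * Real.exp y)) := by
  have hu : ((Real.exp t).toNNReal : ℝ) = Real.exp t := Real.coe_toNNReal _ (Real.exp_pos t).le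
  have hx0 : 0 < x := by rw [hx]; positivity
  have h1 := und_add_dom_le (Real.exp t).toNNReal hy (x := x) (by rw [hu, hx]) (n + 1)
  have h2 : n ! * (c * κ ^ n) ≤ (misWeight 1 (n + 1) : ℝ) := by
    calc (n ! : ℝ) * (c * κ ^ n) ≤ n ! * treeCoeff 1 n sel :=
          mul_le_mul_of_nonneg_left (hsel n) (by positivity)
      _ = treeWeight 1 n sel := by rw [treeCoeff]; field_simp
      _ ≤ _ := NNReal.coe_le_coe.2 (le_misWeight 1 n)
  have h3 : (misWeight (Real.exp t).toNNReal (n + 1) : ℝ) ≤ (n + 1)! *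
      (treeCoeff (Real.exp t).toNNReal (n + 1) und +
        treeCoeff (Real.exp t).toNNReal (n + 1) dom) := by
    refine (NNReal.coe_le_coe.2 (misWeight_le _ _)).trans (le_of_eq ?_)
    rw [treeCoeff, treeCoeff, NNReal.coe_add]
    field_simp
  have hpos : 0 < misWeight 1 (n + 1) :=
    NNReal.coe_pos.1 ((by positivity : 0 < n ! * (c * κ ^ n)).trans_le h2)
  have h4 := (mul_le_mul_of_nonneg_left h2 (Real.exp_pos _).le).trans
    ((exp_mul_En_le hpos t).trans h3)
  rw [hu] at h1
  have h5 := (mul_le_mul_of_nonneg_right h4 (pow_pos hx0 (n + 2)).le)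
  rw [mul_assoc ((n + 1)! : ℝ)] at h5
  have h6 := h5.trans (mul_le_mul_of_nonneg_left h1 (by positivity))
  have hn : (0 : ℝ) < n ! := by positivity
  refine le_of_mul_le_mul_left (le_trans (le_of_eq ?_) (h6.trans (le_of_eq ?_))) hn
  · ring
  · rw [Nat.factorial_succ]; push_cast; ring

theorem eventually_mul_En_div_le {y : ℝ} (hy : 0 < y)
    (hmax : ∀ z : ℝ, 0 < z → z * Real.exp (-(z * (Real.exp (z * Real.exp z) - 1))) ≤
      y * Real.exp (-(y * (Real.exp (y * Real.exp y) - 1)))) (t : ℝ) {ε : ℝ} (hε : 0 < ε) :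
    ∀ᶠ n : ℕ in atTop, t * (En n / n) ≤
      y * (Real.exp (Real.exp t * y * Real.exp y) - Real.exp (y * Real.exp y)) + ε := by
  set r := y * Real.exp (-(y * (Real.exp (y * Real.exp y) - 1))) with hr
  have hr0 : 0 < r := by rw [hr]; positivity
  set κ := Real.exp (-(ε / 2)) / r with hκ
  have hκ0 : 0 < κ := by positivity
  have hκr : κ * r < 1 := by
    rw [hκ, div_mul_cancel₀ _ hr0.ne']
    exact (Real.exp_lt_one_iff).2 (by linarith)
  obtain ⟨c, hc, hsel⟩ := exists_pow_le_treeCoeff_sel hmax hκ0 hκr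
  set x := y * Real.exp (-(y * (Real.exp (Real.exp t * y * Real.exp y) - 1))) with hx
  have hx0 : 0 < x := by rw [hx]; positivity
  set B := y * Real.exp (Real.exp t * y * Real.exp y) with hB
  have hB0 : 0 < B := by positivity
  set L := Real.log B + Real.log κ - Real.log c - Real.log x with hL
  have hlog : Tendsto (fun n : ℕ => Real.log n / n + L / n) atTop (𝓝 (0 + 0)) := by
    refine Tendsto.add ?_ (tendsto_const_div_atTop_nhds_zero_nat L)
    have := Real.isLittleO_log_id_atTop.tendsto_div_nhds_zero
    exact this.comp tendsto_natCast_atTop_atTop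
  have hlt := hlog.eventually (gt_mem_nhds (show (0 : ℝ) + 0 < ε / 2 by linarith))
  filter_upwards [hlt, eventually_gt_atTop 0] with n hn hn0
  obtain ⟨m, rfl⟩ := Nat.exists_eq_succ_of_ne_zero hn0.ne'
  have h1 := exp_mul_En_succ_mul_le hy hc hκ0 hsel t hx m
  rw [← hB] at h1
  have h2 := Real.log_le_log (by positivity) h1
  rw [Real.log_mul (by positivity) (by positivity), Real.log_mul (by positivity) (by positivity),
    Real.log_mul (by positivity) (by positivity), Real.log_mul (by positivity) (by positivity),
    Real.log_exp, Real.log_pow, Real.log_pow] at h2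
  have hlogx : Real.log x = Real.log y - y * (Real.exp (Real.exp t * y * Real.exp y) - 1) := by
    rw [hx, Real.log_mul (by positivity) (by positivity), Real.log_exp]; ring
  have hlogκ : Real.log κ = -(ε / 2) - (Real.log y - y * (Real.exp (y * Real.exp y) - 1)) := by
    rw [hκ, Real.log_div (by positivity) hr0.ne', Real.log_exp, hr,
      Real.log_mul (by positivity) (by positivity), Real.log_exp]; ring
  set S := Real.exp (Real.exp t * y * Real.exp y)
  set S' := Real.exp (y * Real.exp y)
  simp only [Nat.succ_eq_add_one] at hn ⊢
  have hm : (0 : ℝ) < (m + 1 : ℕ) := by positivity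
  rw [← add_div, div_lt_iff₀ hm] at hn
  rw [← mul_div_assoc, div_le_iff₀ hm]
  have h3 : t * En (m + 1) ≤ Real.log (m + 1 : ℕ) + L - (m + 1 : ℕ) * (Real.log κ + Real.log x) := by
    push_cast at h2 ⊢
    rw [hL]
    linarith
  have h4 : Real.log κ + Real.log x = -(ε / 2) - y * (S - S') := by rw [hlogκ, hlogx]; ring
  rw [h4] at h3
  linarith

theorem tendsto_En_div {y : ℝ} (hy : 0 < y)
    (hmax : ∀ z : ℝ, 0 < z → z * Real.exp (-(z * (Real.exp (z * Real.exp z) - 1))) ≤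
      y * Real.exp (-(y * (Real.exp (y * Real.exp y) - 1)))) :
    Tendsto (fun n : ℕ => En n / n) atTop
      (𝓝 (y ^ 2 * Real.exp y * Real.exp (y * Real.exp y))) := by
  set μ := y ^ 2 * Real.exp y * Real.exp (y * Real.exp y) with hμ
  set h : ℝ → ℝ := fun t =>
    y * (Real.exp (Real.exp t * y * Real.exp y) - Real.exp (y * Real.exp y)) with hh
  have hd : HasDerivAt h μ 0 := by
    have := (((((Real.hasDerivAt_exp 0).mul_const y).mul_const (Real.exp y)).exp.sub_const
      (Real.exp (y * Real.exp y))).const_mul y)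
    refine this.congr_deriv ?_
    rw [hμ, Real.exp_zero, one_mul]
    ring
  have hh0 : h 0 = 0 := by simp [hh]
  refine Metric.tendsto_nhds.2 fun δ hδ => ?_
  have hev : ∀ᶠ t in 𝓝 (0 : ℝ), |h t - μ * t| ≤ δ / 3 * |t| := by
    have := (hasDerivAt_iff_isLittleO.1 hd).bound (by positivity : 0 < δ / 3)
    filter_upwards [this] with t ht
    simpa [hh0, mul_comm] using ht
  obtain ⟨s, hs, hball⟩ := Metric.eventually_nhds_iff.1 hev
  have ht : 0 < s / 2 := by positivity
  set t := s / 2 with hts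
  have hp := hball (y := t) (by rw [Real.dist_eq, sub_zero, abs_of_pos ht]; linarith)
  have hn := hball (y := -t) (by rw [Real.dist_eq, sub_zero, abs_neg, abs_of_pos ht]; linarith)
  rw [abs_neg] at hn
  rw [abs_of_pos ht, abs_le] at hp hn
  have hε : 0 < δ / 3 * t := by positivity
  filter_upwards [eventually_mul_En_div_le hy hmax t hε, eventually_mul_En_div_le hy hmax (-t) hε]
    with n h1 h2
  change _ ≤ h t + _ at h1
  change _ ≤ h (-t) + _ at h2
  rw [Real.dist_eq, abs_lt]
  constructor
  · refine lt_of_mul_lt_mul_left ?_ ht.le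
    nlinarith [hn.2]
  · refine lt_of_mul_lt_mul_left ?_ ht.le
    nlinarith [hp.2]

end Limit

theorem stmt_12 :
    ∃ μ : ℝ, 0.46392 < μ ∧ μ < 0.46393 ∧
      Tendsto (fun n : ℕ => En n / (n : ℝ)) atTop (nhds μ) := by
  obtain ⟨y, hy, hmax, hlo, hhi⟩ := exists_maximal_radius
  exact ⟨_, hlo, hhi, tendsto_En_div hy hmax⟩
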